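/- Outer bound (Theorem 2). For every ε ∈ (0,1/4], any rate pair (R01,R02) in R^secrecy_noisy-coord satisfies the following: there exist finite random variables (X1,X2,W,T,U1,U2,X̃1,X̃2,Ỹ,Z̃,Y) with joint pmf factoring as p(x1,x2,w)·p(t)·p(u1,u2|x1,x2,t)·p(x̃1,x̃2|t)·p(ỹ,z̃|x̃1,x̃2)·p(y|u1,u2,w,t), such that ||p(x1,x2,w,y|t) − q(x1,x2,w,y)||₁ ≤ ε for all t, and: (i) I(X̃1;Ỹ|X̃2,T) ≥ I(U1;X1|U2,X2,W,T); (ii) I(X̃2;Ỹ|X̃1,T) ≥ I(U2;X2|U1,X1,W,T); (iii) I(X̃1,X̃2;Ỹ|T) ≥ I(U1,U2;X1,X2|W,T); (iv) R01+R02 ≥ I(U1,U2;X1,X2,Y|W,T) − H(Y|X1,X2,W,T) − I(X̃1,X̃2;Ỹ|Z̃,T) − 2g(ε); (v) R01 ≥ I(U1;X1,X2,Y|W,T) − H(Y|X1,X2,W,T) − I(X̃1,X̃2;Ỹ|Z̃,T) − 2g(ε); (vi) R02 ≥ I(U2;X1,X2,Y|W,T) − H(Y|X1,X2,W,T) − I(X̃1,X̃2;Ỹ|Z̃,T)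 − 2g(ε), where g(ε) = 2√ε·(H_q(X1,X2,W,Y) + log((|𝒳1||𝒳2||𝒲||𝒴||𝒵̃|)/ε)). -/

import Mathlib

open scoped BigOperators

namespace SecCoord

/-- `p` is a probability mass function on the finite type `α`. -/
def IsPMF {α : Type*} [Fintype α] (p : α → ℝ) : Prop :=
  (∀ a, 0 ≤ p a) ∧ ∑ a, p a = 1

/-- Total variation distance between two pmfs: half the `ℓ¹`-distance. -/
noncomputable def TV {α : Type*} [Fintype α] (p q : α → ℝ) : ℝ :=
  (1 / 2) * ∑ a, |p a - q a|

/-- Distribution (pushforward pmf) of a random variable `X : Ω → α` under `μ`. -/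
noncomputable def dist {Ω α : Type*} [Fintype Ω] (μ : Ω → ℝ) (X : Ω → α) : α → ℝ :=
  fun a => ∑ ω, Set.indicator {ω' | X ω' = a} μ ω

/-- Shannon entropy (in bits) of the random variable `X` under `μ`. -/
noncomputable def H {Ω α : Type*} [Fintype Ω] [Fintype α] (μ : Ω → ℝ) (X : Ω → α) : ℝ :=
  -∑ a, dist μ X a * Real.logb 2 (dist μ X a)

/-- Conditional Shannon entropy `H(X | Z)` (in bits). -/
noncomputable def condEnt {Ω α β : Type*} [Fintype Ω] [Fintype α] [Fintype β]
    (μ : Ω → ℝ) (X : Ω → α) (Z : Ω → β) : ℝ :=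
  H μ (fun ω => (X ω, Z ω)) - H μ Z

/-- Mutual information `I(X; Y)` (in bits). -/
noncomputable def MI {Ω α β : Type*} [Fintype Ω] [Fintype α] [Fintype β]
    (μ : Ω → ℝ) (X : Ω → α) (Y : Ω → β) : ℝ :=
  H μ X + H μ Y - H μ (fun ω => (X ω, Y ω))

/-- Conditional mutual information `I(X; Y | Z)` (in bits). -/
noncomputable def CMI {Ω α β γ : Type*} [Fintype Ω] [Fintype α] [Fintype β] [Fintype γ]
    (μ : Ω → ℝ) (X : Ω → α) (Y : Ω → β) (Z : Ω → γ) : ℝ :=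
  (H μ (fun ω => (X ω, Z ω))) + (H μ (fun ω => (Y ω, Z ω)))
    - (H μ (fun ω => (X ω, Y ω, Z ω))) - H μ Z

/-- A `(k1, k2, n)` coordination code for the MAC-WT setting: two randomized
encoders and a randomized decoder. -/
structure Code (X1 X2 W Y Xt1 Xt2 Yt : Type)
    [Fintype X1] [Fintype X2] [Fintype W] [Fintype Y]
    [Fintype Xt1] [Fintype Xt2] [Fintype Yt]
    (n k1 k2 : ℕ) where
  enc1 : (Fin n → X1) → Fin k1 → (Fin n → Xt1) → ℝ
  enc2 : (Fin n → X2) → Fin k2 → (Fin n → Xt2) → ℝ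
  dec : Fin k1 → Fin k2 → (Fin n → W) → (Fin n → Yt) → (Fin n → Y) → ℝ
  enc1_pmf : ∀ x k, IsPMF (enc1 x k)
  enc2_pmf : ∀ x k, IsPMF (enc2 x k)
  dec_pmf : ∀ a b w yt, IsPMF (dec a b w yt)

variable {X1 X2 W Y Xt1 Xt2 Yt Zt : Type}
    [Fintype X1] [Fintype X2] [Fintype W] [Fintype Y]
    [Fintype Xt1] [Fintype Xt2] [Fintype Yt] [Fintype Zt]

/-- The joint distribution of all random variables
`(K1, K2, X1ⁿ, X2ⁿ, Wⁿ, X̃1ⁿ, X̃2ⁿ, Ỹⁿ, Z̃ⁿ, Yⁿ)` induced by a code, the i.i.d. source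
(the `(X1, X2, W)`-marginal of the target pmf `q`) and the memoryless MAC-WT `ch`. -/
noncomputable def pFull (q : X1 × X2 × W × Y → ℝ) (ch : Xt1 × Xt2 → Yt × Zt → ℝ)
    {n k1 k2 : ℕ} (C : Code X1 X2 W Y Xt1 Xt2 Yt n k1 k2) :
    Fin k1 × Fin k2 × (Fin n → X1) × (Fin n → X2) × (Fin n → W) ×
      (Fin n → Xt1) × (Fin n → Xt2) × (Fin n → Yt) × (Fin n → Zt) × (Fin n → Y) → ℝ :=
  fun (a, b, x1, x2, w, s1, s2, yt, z, y) =>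
    (1 / ((k1 : ℝ) * (k2 : ℝ))) * (∏ i, ∑ y' : Y, q (x1 i, x2 i, w i, y')) *
      C.enc1 x1 a s1 * C.enc2 x2 b s2 *
      (∏ i, ch (s1 i, s2 i) (yt i, z i)) * C.dec a b w yt y

/-- The induced joint distribution of `(X1ⁿ, X2ⁿ, Wⁿ, Yⁿ, Z̃ⁿ)`. -/
noncomputable def pInd (q : X1 × X2 × W × Y → ℝ) (ch : Xt1 × Xt2 → Yt × Zt → ℝ)
    {n k1 k2 : ℕ} (C : Code X1 X2 W Y Xt1 Xt2 Yt n k1 k2) :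
    (Fin n → X1) × (Fin n → X2) × (Fin n → W) × (Fin n → Y) × (Fin n → Zt) → ℝ :=
  fun (x1, x2, w, y, z) =>
    ∑ a : Fin k1, ∑ b : Fin k2, ∑ s1 : Fin n → Xt1, ∑ s2 : Fin n → Xt2, ∑ yt : Fin n → Yt,
      pFull q ch C (a, b, x1, x2, w, s1, s2, yt, z, y)

/-- The induced distribution of the eavesdropper observation `Z̃ⁿ`. -/
noncomputable def pIndZ (q : X1 × X2 × W × Y → ℝ) (ch : Xt1 × Xt2 → Yt × Zt → ℝ)
    {n k1 k2 : ℕ} (C : Code X1 X2 W Y Xt1 Xt2 Yt n k1 k2) : (Fin n → Zt) → ℝ :=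
  fun z => ∑ x1 : Fin n → X1, ∑ x2 : Fin n → X2, ∑ w : Fin n → W, ∑ y : Fin n → Y,
    pInd q ch C (x1, x2, w, y, z)

/-- A rate pair `(R01, R02)` is achievable for the target joint pmf `q` with secrecy:
there is a sequence of codes, with shared-randomness alphabets of sizes at most
`2^{n R01}` and `2^{n R02}`, under which the induced distribution of
`(X1ⁿ, X2ⁿ, Wⁿ, Yⁿ, Z̃ⁿ)` converges in total variation to
`p^{ind}_{Z̃ⁿ} ⬝ qⁿ` (i.i.d. coordination plus strong secrecy). -/
def Achievable (q : X1 × X2 × W × Y → ℝ) (ch : Xt1 × Xt2 → Yt × Zt → ℝ)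
    (R01 R02 : ℝ) : Prop :=
  ∃ k1 k2 : ℕ → ℕ,
    (∀ n, 1 ≤ k1 n) ∧ (∀ n, 1 ≤ k2 n) ∧
    (∀ n, (k1 n : ℝ) ≤ 2 ^ ((n : ℝ) * R01)) ∧
    (∀ n, (k2 n : ℝ) ≤ 2 ^ ((n : ℝ) * R02)) ∧
    ∃ C : (n : ℕ) → Code X1 X2 W Y Xt1 Xt2 Yt n (k1 n) (k2 n),
      Filter.Tendsto
        (fun n => TV (pInd q ch (C n))
          (fun v => pIndZ q ch (C n) v.2.2.2.2 *
            ∏ i, q (v.1 i, v.2.1 i, v.2.2.1 i, v.2.2.2.1 i)))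
        Filter.atTop (nhds 0)

/-- The region `𝓡^secrecy_noisy-coord`: the closure of the set of achievable
rate pairs. -/
noncomputable def RegionSecrecy (q : X1 × X2 × W × Y → ℝ)
    (ch : Xt1 × Xt2 → Yt × Zt → ℝ) : Set (ℝ × ℝ) :=
  closure {p : ℝ × ℝ | Achievable q ch p.1 p.2}

/-- The function `g(ε)` appearing in the outer bounds:
`g(ε) = 2√ε (H_q(X1,X2,W,Y) + log(|𝒳1||𝒳2||𝒲||𝒴||𝒵̃|/ε))`. -/
noncomputable def gTV (hq : ℝ) (cards : ℕ) (ε : ℝ) : ℝ :=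
  2 * Real.sqrt ε * (hq + Real.logb 2 ((cards : ℝ) / ε))

section OuterBound

/-- Sample space carrying the single-letter random variables
`(X1, X2, W, T, U1, U2, X̃1, X̃2, Ỹ, Z̃, Y)` of Theorem 2. -/
abbrev Omega1 (X1 X2 W Y Xt1 Xt2 Yt Zt T U1 U2 : Type) : Type :=
  X1 × X2 × W × T × U1 × U2 × Xt1 × Xt2 × Yt × Zt × Y

variable {T U1 U2 : Type}

def wX1 : Omega1 X1 X2 W Y Xt1 Xt2 Yt Zt T U1 U2 → X1 :=
  fun (x1, _, _, _, _, _, _, _, _, _, _) => x1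
def wX2 : Omega1 X1 X2 W Y Xt1 Xt2 Yt Zt T U1 U2 → X2 :=
  fun (_, x2, _, _, _, _, _, _, _, _, _) => x2
def wW : Omega1 X1 X2 W Y Xt1 Xt2 Yt Zt T U1 U2 → W :=
  fun (_, _, w, _, _, _, _, _, _, _, _) => w
def wT : Omega1 X1 X2 W Y Xt1 Xt2 Yt Zt T U1 U2 → T :=
  fun (_, _, _, t, _, _, _, _, _, _, _) => t
def wU1 : Omega1 X1 X2 W Y Xt1 Xt2 Yt Zt T U1 U2 → U1 :=
  fun (_, _, _, _, u1, _, _, _, _, _, _) => u1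
def wU2 : Omega1 X1 X2 W Y Xt1 Xt2 Yt Zt T U1 U2 → U2 :=
  fun (_, _, _, _, _, u2, _, _, _, _, _) => u2
def wA1 : Omega1 X1 X2 W Y Xt1 Xt2 Yt Zt T U1 U2 → Xt1 :=
  fun (_, _, _, _, _, _, a1, _, _, _, _) => a1
def wA2 : Omega1 X1 X2 W Y Xt1 Xt2 Yt Zt T U1 U2 → Xt2 :=
  fun (_, _, _, _, _, _, _, a2, _, _, _) => a2
def wYt : Omega1 X1 X2 W Y Xt1 Xt2 Yt Zt T U1 U2 → Yt :=
  fun (_, _, _, _, _, _, _, _, yt, _, _) => yt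
def wZt : Omega1 X1 X2 W Y Xt1 Xt2 Yt Zt T U1 U2 → Zt :=
  fun (_, _, _, _, _, _, _, _, _, zt, _) => zt
def wY : Omega1 X1 X2 W Y Xt1 Xt2 Yt Zt T U1 U2 → Y :=
  fun (_, _, _, _, _, _, _, _, _, _, y) => y


/-! ### Basic facts on pushforwards and entropy -/

section Basics

set_option linter.unusedSectionVars false

variable {Ω α β γ : Type*} [Fintype Ω] [Fintype α] [Fintype β] [Fintype γ]

open Classical in
lemma dist_eq (μ : Ω → ℝ) (X : Ω → α) (a : α) :
    dist μ X a = ∑ ω, if X ω = a then μ ω else 0 := by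
  unfold dist
  refine Finset.sum_congr rfl fun ω _ => ?_
  simp [Set.indicator_apply]

lemma dist_nonneg {μ : Ω → ℝ} (h : ∀ ω, 0 ≤ μ ω) (X : Ω → α) (a : α) : 0 ≤ dist μ X a := by
  classical
  rw [dist_eq]
  refine Finset.sum_nonneg fun ω _ => ?_
  split_ifs
  · exact h ω
  · exact le_rfl

lemma sum_dist_mul (μ : Ω → ℝ) (X : Ω → α) (f : α → ℝ) :
    ∑ a, dist μ X a * f a = ∑ ω, μ ω * f (X ω) := by
  classical
  simp_rw [dist_eq, Finset.sum_mul]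
  rw [Finset.sum_comm]
  refine Finset.sum_congr rfl fun ω _ => ?_
  simp [ite_mul]

lemma sum_dist (μ : Ω → ℝ) (X : Ω → α) : ∑ a, dist μ X a = ∑ ω, μ ω := by
  simpa using sum_dist_mul μ X (fun _ => 1)

lemma dist_pmf {μ : Ω → ℝ} (h : IsPMF μ) (X : Ω → α) : IsPMF (dist μ X) :=
  ⟨fun a => dist_nonneg h.1 X a, by rw [sum_dist, h.2]⟩

lemma dist_dist (μ : Ω → ℝ) (X : Ω → α) (f : α → β) :
    dist (dist μ X) f = dist μ (fun ω => f (X ω)) := by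
  classical
  funext b
  have := sum_dist_mul μ X (fun a => if f a = b then 1 else 0)
  simp only [mul_ite, mul_one, mul_zero] at this
  rw [dist_eq, dist_eq, this]

lemma dist_marg (μ : Ω → ℝ) (X : Ω → α) (Y : Ω → β) (a : α) :
    ∑ b, dist μ (fun ω => (X ω, Y ω)) (a, b) = dist μ X a := by
  classical
  simp_rw [dist_eq]
  rw [Finset.sum_comm]
  refine Finset.sum_congr rfl fun ω _ => ?_
  simp only [Prod.mk.injEq]
  by_cases h : X ω = a <;> simp [h]

lemma dist_marg' (μ : Ω → ℝ) (X : Ω → α) (Y : Ω → β) (b : β) :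
    ∑ a, dist μ (fun ω => (X ω, Y ω)) (a, b) = dist μ Y b := by
  classical
  simp_rw [dist_eq]
  rw [Finset.sum_comm]
  refine Finset.sum_congr rfl fun ω _ => ?_
  simp only [Prod.mk.injEq]
  by_cases h : Y ω = b <;> simp [h]

lemma dist_id (μ : α → ℝ) : dist μ (fun v => v) = μ := by
  classical
  funext a
  simp [dist_eq]

lemma H_dist (μ : Ω → ℝ) (X : Ω → α) (f : α → β) :
    H (dist μ X) f = H μ (fun ω => f (X ω)) := by
  unfold H
  rw [dist_dist]

lemma H_eq_id (μ : Ω → ℝ) (X : Ω → α) : H μ X = H (dist μ X) (fun v => v) := by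
  rw [H_dist]

lemma H_eq_nml (μ : Ω → ℝ) (X : Ω → α) :
    H μ X = (∑ a, Real.negMulLog (dist μ X a)) / Real.log 2 := by
  unfold H
  rw [Finset.sum_div, ← Finset.sum_neg_distrib]
  refine Finset.sum_congr rfl fun a _ => ?_
  unfold Real.negMulLog Real.logb
  ring

lemma H_eq_omega (μ : Ω → ℝ) (X : Ω → α) :
    H μ X = -∑ ω, μ ω * Real.logb 2 (dist μ X (X ω)) := by
  unfold H
  rw [sum_dist_mul μ X (fun a => Real.logb 2 (dist μ X a))]

lemma H_congr (μ : Ω → ℝ) (X : Ω → α) (Y : Ω → β)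
    (h : ∀ ω ω', X ω = X ω' ↔ Y ω = Y ω') : H μ X = H μ Y := by
  classical
  rw [H_eq_omega, H_eq_omega]
  congr 1
  refine Finset.sum_congr rfl fun ω _ => ?_
  congr 2
  rw [dist_eq, dist_eq]
  refine Finset.sum_congr rfl fun ω' _ => ?_
  simp only [h]

lemma dist_self_pos {μ : Ω → ℝ} (hμ : ∀ ω, 0 ≤ μ ω) (X : Ω → α) (ω : Ω) :
    μ ω ≤ dist μ X (X ω) := by
  classical
  rw [dist_eq]
  have := Finset.single_le_sum (f := fun ω' => if X ω' = X ω then μ ω' else 0)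
    (fun i _ => by split_ifs; exacts [hμ i, le_rfl]) (Finset.mem_univ ω)
  simpa using this

lemma H_mono {μ : Ω → ℝ} (hμ : ∀ ω, 0 ≤ μ ω) (X : Ω → α) (Y : Ω → β)
    (h : ∀ ω ω', Y ω = Y ω' → X ω = X ω') : H μ X ≤ H μ Y := by
  classical
  rw [H_eq_omega, H_eq_omega]
  refine neg_le_neg (Finset.sum_le_sum fun ω _ => ?_)
  rcases (hμ ω).eq_or_lt with h0 | h0
  · simp [← h0]
  refine mul_le_mul_of_nonneg_left ?_ (hμ ω)
  refine Real.logb_le_logb_of_le (by norm_num) (h0.trans_le (dist_self_pos hμ Y ω)) ?_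
  rw [dist_eq, dist_eq]
  refine Finset.sum_le_sum fun ω' _ => ?_
  by_cases h1 : Y ω' = Y ω
  · simp [h1, h _ _ h1]
  · simp only [h1, if_false]
    split_ifs
    exacts [hμ ω', le_rfl]

lemma CMI_nonneg {μ : Ω → ℝ} (hμ : IsPMF μ) (X : Ω → α) (Y : Ω → β) (Z : Ω → γ) :
    0 ≤ CMI μ X Y Z := by
  classical
  have key : ∑ ω, μ ω * (dist μ (fun ω => (X ω, Z ω)) (X ω, Z ω) *
      dist μ (fun ω => (Y ω, Z ω)) (Y ω, Z ω) /
      (dist μ (fun ω => (X ω, Y ω, Z ω)) (X ω, Y ω, Z ω) * dist μ Z (Z ω))) ≤ 1 := by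
    rw [← sum_dist_mul μ (fun ω => (X ω, Y ω, Z ω)) (fun v =>
      dist μ (fun ω => (X ω, Z ω)) (v.1, v.2.2) * dist μ (fun ω => (Y ω, Z ω)) (v.2.1, v.2.2) /
      (dist μ (fun ω => (X ω, Y ω, Z ω)) v * dist μ Z v.2.2))]
    have h1 : ∀ v : α × β × γ, dist μ (fun ω => (X ω, Y ω, Z ω)) v *
        (dist μ (fun ω => (X ω, Z ω)) (v.1, v.2.2) * dist μ (fun ω => (Y ω, Z ω)) (v.2.1, v.2.2) /
      (dist μ (fun ω => (X ω, Y ω, Z ω)) v * dist μ Z v.2.2)) ≤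
        dist μ (fun ω => (X ω, Z ω)) (v.1, v.2.2) * dist μ (fun ω => (Y ω, Z ω)) (v.2.1, v.2.2) /
          dist μ Z v.2.2 := by
      intro v
      have a1 := dist_nonneg hμ.1 (fun ω => (X ω, Z ω)) (v.1, v.2.2)
      have a2 := dist_nonneg hμ.1 (fun ω => (Y ω, Z ω)) (v.2.1, v.2.2)
      have a3 := dist_nonneg hμ.1 Z v.2.2
      rcases eq_or_ne (dist μ (fun ω => (X ω, Y ω, Z ω)) v) 0 with h | h
      · rw [h, zero_mul]; positivity
      · rw [mul_div_assoc', mul_div_mul_left _ _ h]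
    refine (Finset.sum_le_sum fun v _ => h1 v).trans ?_
    simp only [Fintype.sum_prod_type]
    calc ∑ x, ∑ y, ∑ z, dist μ (fun ω => (X ω, Z ω)) (x, z) * dist μ (fun ω => (Y ω, Z ω)) (y, z) /
          dist μ Z z
        = ∑ z, (∑ x, dist μ (fun ω => (X ω, Z ω)) (x, z)) *
            (∑ y, dist μ (fun ω => (Y ω, Z ω)) (y, z)) / dist μ Z z := by
          simp_rw [Finset.sum_mul_sum, Finset.sum_div]
          rw [Finset.sum_comm]
          conv_rhs => rw [Finset.sum_comm]; enter [2, x]; rw [Finset.sum_comm]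
          rw [Finset.sum_comm]
      _ ≤ ∑ z, dist μ Z z := by
          refine Finset.sum_le_sum fun z _ => ?_
          rw [dist_marg', dist_marg']
          rcases eq_or_ne (dist μ Z z) 0 with h | h
          · simp [h]
          · rw [mul_div_assoc, div_self h, mul_one]
      _ = 1 := by rw [sum_dist, hμ.2]
  have hl2 : 0 < Real.log 2 := Real.log_pos (by norm_num)
  unfold CMI
  simp only [H_eq_omega]
  have e : (-∑ ω, μ ω * Real.logb 2 (dist μ (fun ω => (X ω, Z ω)) (X ω, Z ω)) +
      -∑ ω, μ ω * Real.logb 2 (dist μ (fun ω => (Y ω, Z ω)) (Y ω, Z ω)) -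
      -∑ ω, μ ω * Real.logb 2 (dist μ (fun ω => (X ω, Y ω, Z ω)) (X ω, Y ω, Z ω)) -
      -∑ ω, μ ω * Real.logb 2 (dist μ Z (Z ω))) * Real.log 2 =
      ∑ ω, μ ω * (Real.log (dist μ (fun ω => (X ω, Y ω, Z ω)) (X ω, Y ω, Z ω)) +
        Real.log (dist μ Z (Z ω)) - Real.log (dist μ (fun ω => (X ω, Z ω)) (X ω, Z ω)) -
        Real.log (dist μ (fun ω => (Y ω, Z ω)) (Y ω, Z ω))) := by
    simp only [← Finset.sum_neg_distrib, ← Finset.sum_add_distrib, ← Finset.sum_sub_distrib,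
      Finset.sum_mul]
    refine Finset.sum_congr rfl fun ω _ => ?_
    unfold Real.logb
    field_simp
    ring
  refine nonneg_of_mul_nonneg_left (b := Real.log 2) ?_ hl2
  rw [e]
  have h2 : ∀ ω, μ ω * (1 - dist μ (fun ω => (X ω, Z ω)) (X ω, Z ω) *
      dist μ (fun ω => (Y ω, Z ω)) (Y ω, Z ω) /
      (dist μ (fun ω => (X ω, Y ω, Z ω)) (X ω, Y ω, Z ω) * dist μ Z (Z ω))) ≤
      μ ω * (Real.log (dist μ (fun ω => (X ω, Y ω, Z ω)) (X ω, Y ω, Z ω)) +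
        Real.log (dist μ Z (Z ω)) - Real.log (dist μ (fun ω => (X ω, Z ω)) (X ω, Z ω)) -
        Real.log (dist μ (fun ω => (Y ω, Z ω)) (Y ω, Z ω))) := by
    intro ω
    rcases (hμ.1 ω).eq_or_lt with h0 | h0
    · simp [← h0]
    refine mul_le_mul_of_nonneg_left ?_ h0.le
    have b1 := h0.trans_le (dist_self_pos hμ.1 (fun ω => (X ω, Z ω)) ω)
    have b2 := h0.trans_le (dist_self_pos hμ.1 (fun ω => (Y ω, Z ω)) ω)
    have b3 := h0.trans_le (dist_self_pos hμ.1 (fun ω => (X ω, Y ω, Z ω)) ω)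
    have b4 := h0.trans_le (dist_self_pos hμ.1 Z ω)
    have := Real.log_le_sub_one_of_pos (div_pos (mul_pos b1 b2) (mul_pos b3 b4))
    rw [Real.log_div (mul_pos b1 b2).ne' (mul_pos b3 b4).ne', Real.log_mul b1.ne' b2.ne',
      Real.log_mul b3.ne' b4.ne'] at this
    linarith
  refine le_trans ?_ (Finset.sum_le_sum fun ω _ => h2 ω)
  simp only [mul_sub, mul_one, Finset.sum_sub_distrib, hμ.2]
  linarith

/-- Submodularity, in a form convenient for arbitrary arrangements of tuples. -/
lemma H_submod {δ : Type*} [Fintype δ] {μ : Ω → ℝ} (hμ : IsPMF μ)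
    (J : Ω → δ) (C : Ω → γ) (A : Ω → α) (B : Ω → β)
    (hJ : ∀ ω ω', J ω = J ω' ↔ A ω = A ω' ∧ B ω = B ω')
    (hA : ∀ ω ω', A ω = A ω' → C ω = C ω') (hB : ∀ ω ω', B ω = B ω' → C ω = C ω') :
    H μ J + H μ C ≤ H μ A + H μ B := by
  have h := CMI_nonneg hμ A B C
  unfold CMI at h
  rw [H_congr μ (fun ω => (A ω, C ω)) A (by simp; tauto),
    H_congr μ (fun ω => (B ω, C ω)) B (by simp; tauto),
    H_congr μ (fun ω => (A ω, B ω, C ω)) J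
      (by intro ω ω'; simp only [Prod.mk.injEq, hJ]; have := hA ω ω'; tauto)] at h
  linarith

lemma H_nonneg {μ : Ω → ℝ} (hμ : IsPMF μ) (X : Ω → α) : 0 ≤ H μ X := by
  have h := H_mono hμ.1 (fun _ : Ω => ()) X (by simp)
  refine le_trans (le_of_eq ?_) h
  rw [H_eq_omega]
  have : dist μ (fun _ : Ω => ()) () = 1 := by
    classical
    rw [dist_eq]; simpa using hμ.2
  simp [this]

/-- `∑ η(r) ≤ τ log N + η(τ)` for nonnegative `r` of mass `τ`. -/
lemma sum_negMulLog_le (r : α → ℝ) (hr : ∀ a, 0 ≤ r a) :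
    ∑ a, Real.negMulLog (r a) ≤
      (∑ a, r a) * Real.log (Fintype.card α) + Real.negMulLog (∑ a, r a) := by
  set τ := ∑ a, r a with hτ
  rcases (Finset.sum_nonneg fun a _ => hr a : 0 ≤ ∑ a, r a).eq_or_lt with h0 | h0
  · have : ∀ a, r a = 0 := by
      intro a
      exact (Finset.sum_eq_zero_iff_of_nonneg (fun a _ => hr a)).1 h0.symm a (Finset.mem_univ a)
    have h1 : τ = 0 := h0.symm
    simp [this, h1]
  have hN : 0 < (Fintype.card α : ℝ) := by
    have : Nonempty α := by
      by_contra h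
      rw [not_nonempty_iff] at h
      simp at h0
    exact_mod_cast Fintype.card_pos
  have hτ0 : 0 < τ := h0
  have h1 : ∀ a, Real.negMulLog (r a) ≤
      r a * (Real.log (Fintype.card α) - Real.log τ) + (τ / Fintype.card α - r a) := by
    intro a
    rcases (hr a).eq_or_lt with h | h
    · rw [← h]; simp; positivity
    have := Real.log_le_sub_one_of_pos (x := τ / (Fintype.card α * r a)) (by positivity)
    rw [Real.log_div hτ0.ne' (by positivity), Real.log_mul hN.ne' h.ne'] at this
    have h2 := mul_le_mul_of_nonneg_left this h.le
    have h3 : r a * (τ / (Fintype.card α * r a) - 1) = τ / Fintype.card α - r a := by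
      field_simp
    rw [h3] at h2
    unfold Real.negMulLog
    linarith
  refine (Finset.sum_le_sum fun a _ => h1 a).trans (le_of_eq ?_)
  rw [Finset.sum_add_distrib, ← Finset.sum_mul, Finset.sum_sub_distrib, ← hτ]
  simp only [Finset.sum_const, Finset.card_univ, nsmul_eq_mul]
  unfold Real.negMulLog
  field_simp
  ring

lemma H_le_card {μ : Ω → ℝ} (hμ : IsPMF μ) (X : Ω → α) :
    H μ X ≤ Real.logb 2 (Fintype.card α) := by
  have h := sum_negMulLog_le (dist μ X) (dist_nonneg hμ.1 X)
  rw [sum_dist, hμ.2] at h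
  rw [H_eq_nml]
  unfold Real.logb
  have hl2 : 0 < Real.log 2 := Real.log_pos (by norm_num)
  gcongr
  simpa using h

lemma negMulLog_add_le {x y : ℝ} (hx : 0 ≤ x) (hy : 0 ≤ y) :
    Real.negMulLog (x + y) ≤ Real.negMulLog x + Real.negMulLog y := by
  rcases hx.eq_or_lt with h | h
  · simp [← h]
  rcases hy.eq_or_lt with h' | h'
  · simp [← h']
  have h1 := Real.log_le_log h (by linarith : x ≤ x + y)
  have h2 := Real.log_le_log h' (by linarith : y ≤ x + y)
  unfold Real.negMulLog
  nlinarith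

lemma negMulLog_add_ge {m s : ℝ} (hm : 0 ≤ m) (hs : 0 ≤ s) (h1 : m + s ≤ 1) :
    Real.negMulLog m - s ≤ Real.negMulLog (m + s) := by
  rcases hm.eq_or_lt with h | h
  · rw [← h] at *
    simp only [Real.negMulLog_zero, zero_add] at *
    unfold Real.negMulLog
    have := Real.log_nonpos hs (by linarith : s ≤ 1)
    nlinarith
  have h3 : Real.log (m + s) ≤ Real.log m + s / m := by
    have := Real.log_le_sub_one_of_pos (x := (m + s) / m) (by positivity)
    rw [Real.log_div (by positivity) h.ne'] at this
    have e : (m + s) / m - 1 = s / m := by field_simp; ring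
    linarith
  have h4 : m * Real.log (m + s) ≤ m * Real.log m + s := by
    have := mul_le_mul_of_nonneg_left h3 hm
    rw [mul_add, mul_div_cancel₀ _ h.ne'] at this
    exact this
  have h5 := Real.log_nonpos (by linarith : 0 ≤ m + s) h1
  unfold Real.negMulLog
  nlinarith

/-- Fannes-type continuity (natural logs). -/
lemma nml_cont (p q : α → ℝ) (hp : IsPMF p) (hq : IsPMF q) :
    ∑ a, Real.negMulLog (p a) ≤ ∑ a, Real.negMulLog (q a) +
      (TV p q * (Real.log (Fintype.card α) + 1) + Real.negMulLog (TV p q)) := by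
  have hr : ∑ a, (p a - min (p a) (q a)) = TV p q := by
    have h1 : ∀ a, p a - min (p a) (q a) = (1/2) * (|p a - q a| + (p a - q a)) := by
      intro a
      rcases le_total (p a) (q a) with h | h
      · rw [min_eq_left h, abs_of_nonpos (by linarith)]; ring
      · rw [min_eq_right h, abs_of_nonneg (by linarith)]; ring
    simp_rw [h1]
    rw [← Finset.mul_sum, Finset.sum_add_distrib, Finset.sum_sub_distrib, hp.2, hq.2]
    unfold TV; ring
  have hs : ∑ a, (q a - min (p a) (q a)) = TV p q := by
    rw [← hr, Finset.sum_sub_distrib, Finset.sum_sub_distrib, hp.2, hq.2]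
  have hq1 : ∀ a, q a ≤ 1 := by
    intro a
    rw [← hq.2]
    exact Finset.single_le_sum (f := q) (fun i _ => hq.1 i) (Finset.mem_univ a)
  have h1 : ∀ a, Real.negMulLog (p a) ≤ Real.negMulLog (q a) + (q a - min (p a) (q a)) +
      Real.negMulLog (p a - min (p a) (q a)) := by
    intro a
    have hm : 0 ≤ min (p a) (q a) := le_min (hp.1 a) (hq.1 a)
    have e1 := negMulLog_add_le hm (sub_nonneg.2 (min_le_left (p a) (q a)))
    have e2 := negMulLog_add_ge hm (sub_nonneg.2 (min_le_right (p a) (q a)))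
      (by simpa using hq1 a)
    simp only [add_sub_cancel] at e1 e2
    linarith
  have h2 := sum_negMulLog_le (fun a => p a - min (p a) (q a))
    (fun a => sub_nonneg.2 (min_le_left (p a) (q a)))
  rw [hr] at h2
  have h3 := Finset.sum_le_sum fun a (_ : a ∈ Finset.univ) => h1 a
  rw [Finset.sum_add_distrib, Finset.sum_add_distrib, hs] at h3
  linarith

lemma TV_comm (p q : α → ℝ) : TV p q = TV q p := by
  unfold TV
  simp_rw [abs_sub_comm]

lemma TV_nonneg (p q : α → ℝ) : 0 ≤ TV p q := by
  unfold TV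
  positivity

lemma TV_dist (p q : Ω → ℝ) (X : Ω → α) : TV (dist p X) (dist q X) ≤ TV p q := by
  classical
  unfold TV
  gcongr
  have h1 : ∀ a, |dist p X a - dist q X a| ≤ dist (fun ω => |p ω - q ω|) X a := by
    intro a
    rw [dist_eq, dist_eq, dist_eq, ← Finset.sum_sub_distrib]
    refine (Finset.abs_sum_le_sum_abs _ _).trans (le_of_eq ?_)
    refine Finset.sum_congr rfl fun ω _ => ?_
    split_ifs <;> simp
  refine (Finset.sum_le_sum fun a _ => h1 a).trans ?_
  rw [sum_dist]

end Basics

section Poly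

set_option linter.unusedSectionVars false

variable {Ω α β γ ρ : Type*} [Fintype Ω] [Fintype α] [Fintype β] [Fintype γ] [Fintype ρ]

lemma H_subadd {μ : Ω → ℝ} (hμ : IsPMF μ) {n : ℕ} (G : Ω → Fin n → α) (R : Ω → ρ) :
    H μ (fun ω => (G ω, R ω)) - H μ R ≤ ∑ i, (H μ (fun ω => (G ω i, R ω)) - H μ R) := by
  induction n with
  | zero =>
    rw [H_congr μ (fun ω => (G ω, R ω)) R (by intro ω ω'; simp [Subsingleton.elim (G ω) (G ω')])]
    simp
  | succ n ih =>
    have h1 := ih (fun ω i => G ω i.castSucc)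
    rw [Fin.sum_univ_castSucc]
    have h2 := H_submod hμ (fun ω => (G ω, R ω)) R (fun ω => ((fun i : Fin n => G ω i.castSucc), R ω))
      (fun ω => (G ω (Fin.last n), R ω))
      (by
        intro ω ω'
        simp only [Prod.mk.injEq, funext_iff, Fin.forall_fin_succ']
        tauto)
      (by simp) (by simp)
    linarith

/-- Conditional subadditivity with relaxed conditioning. -/
lemma H_subadd' {φ δ : Type*} [Fintype φ] [Fintype δ] {μ : Ω → ℝ} (hμ : IsPMF μ) {n : ℕ}
    (J : Ω → δ) (G : Ω → Fin n → α) (R : Ω → ρ) (F : Fin n → Ω → φ)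
    (hJ : ∀ ω ω', J ω = J ω' ↔ G ω = G ω' ∧ R ω = R ω')
    (hF : ∀ i ω ω', R ω = R ω' → F i ω = F i ω') :
    H μ J - H μ R ≤ ∑ i, (H μ (fun ω => (G ω i, F i ω)) - H μ (F i)) := by
  have h := H_subadd hμ G R
  rw [H_congr μ J (fun ω => (G ω, R ω)) (by intro ω ω'; rw [hJ]; simp)]
  refine h.trans (Finset.sum_le_sum fun i _ => ?_)
  have := H_submod hμ (fun ω => (G ω i, R ω)) (F i) (fun ω => (G ω i, F i ω)) R
    (by intro ω ω'; simp only [Prod.mk.injEq]; have := hF i ω ω'; tauto)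
    (by simp) (hF i)
  linarith

lemma H_unit {μ : Ω → ℝ} (hμ : IsPMF μ) : H μ (fun _ : Ω => ()) = 0 := by
  rw [H_eq_omega]
  have : dist μ (fun _ : Ω => ()) () = 1 := by
    classical
    rw [dist_eq]; simpa using hμ.2
  simp [this]

lemma H_subadd0 {μ : Ω → ℝ} (hμ : IsPMF μ) {n : ℕ} (G : Ω → Fin n → α) :
    H μ G ≤ ∑ i, H μ (fun ω => G ω i) := by
  have h := H_subadd' hμ G G (fun _ => ()) (fun _ _ => ()) (by simp) (by simp)
  rw [H_unit hμ] at h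
  simp only [sub_zero] at h
  refine h.trans (le_of_eq (Finset.sum_congr rfl fun i _ => ?_))
  exact H_congr _ _ _ (by simp)

lemma H_pair_le {δ : Type*} [Fintype δ] {μ : Ω → ℝ} (hμ : IsPMF μ) (J : Ω → δ) (A : Ω → α) (B : Ω → β)
    (hJ : ∀ ω ω', J ω = J ω' ↔ A ω = A ω' ∧ B ω = B ω') : H μ J ≤ H μ A + H μ B := by
  have := H_submod hμ J (fun _ => ()) A B hJ (by simp) (by simp)
  rw [H_unit hμ] at this
  linarith

variable {X1 X2 W Y S1 S2 V Z K L : Type} [Fintype X1] [Fintype X2] [Fintype W] [Fintype Y]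
  [Fintype S1] [Fintype S2] [Fintype V] [Fintype Z] [Fintype K] [Fintype L] {n : ℕ}

/-- The channel fact for the legitimate output alone. -/
lemma chan_V {μ : Ω → ℝ} (hμ : IsPMF μ) (s1 : Ω → Fin n → S1) (s2 : Ω → Fin n → S2)
    (v : Ω → Fin n → V) (z : Ω → Fin n → Z) (r : Ω → ρ)
    (hD : ∑ t, (H μ (fun ω => (v ω t, z ω t, s1 ω t, s2 ω t)) - H μ (fun ω => (s1 ω t, s2 ω t))) ≤
      H μ (fun ω => (v ω, z ω, s1 ω, s2 ω, r ω)) - H μ (fun ω => (s1 ω, s2 ω, r ω))) :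
    ∑ t, (H μ (fun ω => (v ω t, s1 ω t, s2 ω t)) - H μ (fun ω => (s1 ω t, s2 ω t))) ≤
      H μ (fun ω => (v ω, s1 ω, s2 ω, r ω)) - H μ (fun ω => (s1 ω, s2 ω, r ω)) := by
  have h := H_subadd' hμ (fun ω => (v ω, z ω, s1 ω, s2 ω, r ω)) z
    (fun ω => (v ω, s1 ω, s2 ω, r ω)) (fun t ω => (v ω t, s1 ω t, s2 ω t))
    (by intro ω ω'; simp only [Prod.mk.injEq]; tauto)
    (by intro t ω ω'; simp only [Prod.mk.injEq]; rintro ⟨h1, h2, h3, h4⟩; simp [h1, h2, h3])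
  have e : ∀ t, H μ (fun ω => (z ω t, v ω t, s1 ω t, s2 ω t)) =
      H μ (fun ω => (v ω t, z ω t, s1 ω t, s2 ω t)) := fun t =>
    H_congr _ _ _ (by intro ω ω'; simp only [Prod.mk.injEq]; tauto)
  simp only [e, Finset.sum_sub_distrib] at *
  linarith

/-- The channel fact for the legitimate output given the eavesdropper output. -/
lemma chan_VZ {μ : Ω → ℝ} (hμ : IsPMF μ) (s1 : Ω → Fin n → S1) (s2 : Ω → Fin n → S2)
    (v : Ω → Fin n → V) (z : Ω → Fin n → Z) (r : Ω → ρ)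
    (hD : ∑ t, (H μ (fun ω => (v ω t, z ω t, s1 ω t, s2 ω t)) - H μ (fun ω => (s1 ω t, s2 ω t))) ≤
      H μ (fun ω => (v ω, z ω, s1 ω, s2 ω, r ω)) - H μ (fun ω => (s1 ω, s2 ω, r ω))) :
    ∑ t, (H μ (fun ω => (v ω t, z ω t, s1 ω t, s2 ω t)) -
        H μ (fun ω => (z ω t, s1 ω t, s2 ω t))) ≤
      H μ (fun ω => (v ω, z ω, s1 ω, s2 ω, r ω)) - H μ (fun ω => (z ω, s1 ω, s2 ω, r ω)) := by
  have h := H_subadd' hμ (fun ω => (z ω, s1 ω, s2 ω, r ω)) z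
    (fun ω => (s1 ω, s2 ω, r ω)) (fun t ω => (s1 ω t, s2 ω t))
    (by intro ω ω'; simp only [Prod.mk.injEq])
    (by intro t ω ω'; simp only [Prod.mk.injEq]; rintro ⟨h1, h2, h3⟩; simp [h1, h2])
  simp only [Finset.sum_sub_distrib] at *
  linarith

/-- Core of (2a)/(2b). -/
lemma core1 {μ : Ω → ℝ} (hμ : IsPMF μ) (x1 : Ω → Fin n → X1) (x2 : Ω → Fin n → X2)
    (w : Ω → Fin n → W) (s1 : Ω → Fin n → S1) (s2 : Ω → Fin n → S2)
    (v : Ω → Fin n → V) (k : Ω → K)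
    (hA : H μ k + H μ (fun ω => (x1 ω, x2 ω, w ω)) ≤ H μ (fun ω => (k ω, x1 ω, x2 ω, w ω)))
    (hB : ∑ t, H μ (fun ω => (x1 ω t, x2 ω t, w ω t)) ≤ H μ (fun ω => (x1 ω, x2 ω, w ω)))
    (hC : H μ (fun ω => (k ω, x1 ω, x2 ω, w ω)) + H μ (fun ω => (s2 ω, k ω, x2 ω, w ω)) ≤
      H μ (fun ω => (s2 ω, k ω, x1 ω, x2 ω, w ω)) + H μ (fun ω => (k ω, x2 ω, w ω)))
    (hD : ∑ t, (H μ (fun ω => (v ω t, s1 ω t, s2 ω t)) - H μ (fun ω => (s1 ω t, s2 ω t))) ≤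
      H μ (fun ω => (v ω, s1 ω, s2 ω, (k ω, x1 ω, x2 ω, w ω))) -
        H μ (fun ω => (s1 ω, s2 ω, (k ω, x1 ω, x2 ω, w ω)))) :
    ∑ t, ((H μ (fun ω => (x1 ω t, x2 ω t, w ω t)) - H μ (fun ω => (x2 ω t, w ω t))) +
      (H μ (fun ω => (k ω, v ω, w ω, x2 ω t)) - H μ (fun ω => (x1 ω t, k ω, v ω, w ω, x2 ω t)))) ≤
    ∑ t, CMI μ (fun ω => s1 ω t) (fun ω => v ω t) (fun ω => s2 ω t) := by
  have a1 := H_subadd' hμ (fun ω => (x1 ω, k ω, v ω, w ω, x2 ω)) x1 (fun ω => (k ω, v ω, w ω, x2 ω))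
    (fun t ω => (k ω, v ω, w ω, x2 ω t)) (by intro ω ω'; simp only [Prod.mk.injEq])
    (by intro t ω ω'; simp only [Prod.mk.injEq]; rintro ⟨h1, h2, h3, h4⟩; simp [h1, h2, h3, h4])
  have a2 := H_subadd0 hμ (fun ω t => (x2 ω t, w ω t))
  rw [H_congr μ (fun ω t => (x2 ω t, w ω t)) (fun ω => (x2 ω, w ω))
    (by intro ω ω'; simp only [Prod.mk.injEq, funext_iff, forall_and])] at a2
  have a3 := H_subadd' hμ (fun ω => (v ω, s2 ω)) v s2 (fun t ω => s2 ω t)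
    (by intro ω ω'; simp only [Prod.mk.injEq])
    (by intro t ω ω' h; rw [h])
  have e : ∀ t, CMI μ (fun ω => s1 ω t) (fun ω => v ω t) (fun ω => s2 ω t) =
      (H μ (fun ω => (s1 ω t, s2 ω t)) - H μ (fun ω => (v ω t, s1 ω t, s2 ω t)))
      + (H μ (fun ω => (v ω t, s2 ω t)) - H μ (fun ω => s2 ω t)) := by
    intro t
    unfold CMI
    rw [H_congr μ (fun ω => (s1 ω t, v ω t, s2 ω t)) (fun ω => (v ω t, s1 ω t, s2 ω t))
      (by intro ω ω'; simp only [Prod.mk.injEq]; tauto)]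
    ring
  have b1 := H_submod hμ (fun ω => (v ω, s1 ω, s2 ω, (k ω, x1 ω, x2 ω, w ω)))
    (fun ω => (s2 ω, k ω, x1 ω, x2 ω, w ω)) (fun ω => (v ω, s2 ω, k ω, x1 ω, x2 ω, w ω))
    (fun ω => (s1 ω, s2 ω, (k ω, x1 ω, x2 ω, w ω)))
    (by intro ω ω'; simp only [Prod.mk.injEq]; tauto)
    (by intro ω ω'; simp only [Prod.mk.injEq]; tauto)
    (by intro ω ω'; simp only [Prod.mk.injEq]; tauto)
  have b2 := H_submod hμ (fun ω => (v ω, s2 ω, k ω, x2 ω, w ω)) s2 (fun ω => (v ω, s2 ω))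
    (fun ω => (s2 ω, k ω, x2 ω, w ω))
    (by intro ω ω'; simp only [Prod.mk.injEq]; tauto)
    (by intro ω ω'; simp only [Prod.mk.injEq]; tauto)
    (by intro ω ω'; simp only [Prod.mk.injEq]; tauto)
  have b3 := H_submod hμ (fun ω => (v ω, s2 ω, k ω, x1 ω, x2 ω, w ω)) (fun ω => (k ω, v ω, w ω, x2 ω))
    (fun ω => (v ω, s2 ω, k ω, x2 ω, w ω)) (fun ω => (x1 ω, k ω, v ω, w ω, x2 ω))
    (by intro ω ω'; simp only [Prod.mk.injEq]; tauto)
    (by intro ω ω'; simp only [Prod.mk.injEq]; tauto)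
    (by intro ω ω'; simp only [Prod.mk.injEq]; tauto)
  have b4 := H_pair_le hμ (fun ω => (k ω, x2 ω, w ω)) k (fun ω => (x2 ω, w ω))
    (by intro ω ω'; simp only [Prod.mk.injEq])
  simp only [e, Finset.sum_sub_distrib, Finset.sum_add_distrib] at *
  linarith

/-- Core of (2c). -/
lemma core3 {μ : Ω → ℝ} (hμ : IsPMF μ) (x1 : Ω → Fin n → X1) (x2 : Ω → Fin n → X2)
    (w : Ω → Fin n → W) (s1 : Ω → Fin n → S1) (s2 : Ω → Fin n → S2)
    (v : Ω → Fin n → V) (k : Ω → K)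
    (hA : H μ k + H μ (fun ω => (x1 ω, x2 ω, w ω)) ≤ H μ (fun ω => (k ω, x1 ω, x2 ω, w ω)))
    (hB : ∑ t, H μ (fun ω => (x1 ω t, x2 ω t, w ω t)) ≤ H μ (fun ω => (x1 ω, x2 ω, w ω)))
    (hD : ∑ t, (H μ (fun ω => (v ω t, s1 ω t, s2 ω t)) - H μ (fun ω => (s1 ω t, s2 ω t))) ≤
      H μ (fun ω => (v ω, s1 ω, s2 ω, (k ω, x1 ω, x2 ω, w ω))) -
        H μ (fun ω => (s1 ω, s2 ω, (k ω, x1 ω, x2 ω, w ω)))) :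
    ∑ t, ((H μ (fun ω => (x1 ω t, x2 ω t, w ω t)) - H μ (fun ω => w ω t)) +
      (H μ (fun ω => (k ω, v ω, w ω)) - H μ (fun ω => ((x1 ω t, x2 ω t), k ω, v ω, w ω)))) ≤
    ∑ t, CMI μ (fun ω => (s1 ω t, s2 ω t)) (fun ω => v ω t) (fun _ => ()) := by
  have a1 := H_subadd' hμ (fun ω => (x1 ω, x2 ω, k ω, v ω, w ω)) (fun ω t => (x1 ω t, x2 ω t))
    (fun ω => (k ω, v ω, w ω))
    (fun t ω => (k ω, v ω, w ω))
    (by intro ω ω'; simp only [Prod.mk.injEq, funext_iff, forall_and]; tauto)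
    (by intro t ω ω'; exact id)
  have a2 := H_subadd0 hμ w
  have a3 := H_subadd0 hμ v
  have e : ∀ t, CMI μ (fun ω => (s1 ω t, s2 ω t)) (fun ω => v ω t) (fun _ => ()) =
      (H μ (fun ω => (s1 ω t, s2 ω t)) - H μ (fun ω => (v ω t, s1 ω t, s2 ω t)))
      + H μ (fun ω => v ω t) := by
    intro t
    unfold CMI
    rw [H_unit hμ, H_congr μ (fun ω => ((s1 ω t, s2 ω t), v ω t, ()))
        (fun ω => (v ω t, s1 ω t, s2 ω t))
        (by intro ω ω'; simp only [Prod.mk.injEq]; tauto),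
      H_congr μ (fun ω => ((s1 ω t, s2 ω t), ())) (fun ω => (s1 ω t, s2 ω t)) (by simp),
      H_congr μ (fun ω => (v ω t, ())) (fun ω => v ω t) (by simp)]
    ring
  have b1 := H_submod hμ (fun ω => (v ω, s1 ω, s2 ω, (k ω, x1 ω, x2 ω, w ω)))
    (fun ω => (k ω, x1 ω, x2 ω, w ω)) (fun ω => (x1 ω, x2 ω, k ω, v ω, w ω))
    (fun ω => (s1 ω, s2 ω, (k ω, x1 ω, x2 ω, w ω)))
    (by intro ω ω'; simp only [Prod.mk.injEq]; tauto)
    (by intro ω ω'; simp only [Prod.mk.injEq]; tauto)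
    (by intro ω ω'; simp only [Prod.mk.injEq]; tauto)
  have b2 := H_pair_le hμ (fun ω => (k ω, v ω, w ω)) k (fun ω => (v ω, w ω))
    (by intro ω ω'; simp only [Prod.mk.injEq])
  have b3 := H_pair_le hμ (fun ω => (v ω, w ω)) v w
    (by intro ω ω'; simp only [Prod.mk.injEq])
  simp only [e, Finset.sum_sub_distrib, Finset.sum_add_distrib] at *
  linarith

/-- Core of (2d)-(2f). -/
lemma core2 {μ : Ω → ℝ} (hμ : IsPMF μ) (x1 : Ω → Fin n → X1) (x2 : Ω → Fin n → X2)
    (w : Ω → Fin n → W) (y : Ω → Fin n → Y) (s1 : Ω → Fin n → S1) (s2 : Ω → Fin n → S2)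
    (v : Ω → Fin n → V) (z : Ω → Fin n → Z) (k : Ω → K) (l : Ω → L) (d r : ℝ)
    (hl : H μ l ≤ r)
    (hE1 : ∑ t, H μ (fun ω => (x1 ω t, x2 ω t, w ω t, y ω t)) ≤
      H μ (fun ω => (x1 ω, x2 ω, w ω, y ω)) + d)
    (hE2 : H μ (fun ω => (x1 ω, x2 ω, w ω, y ω)) + H μ z ≤
      H μ (fun ω => (z ω, x1 ω, x2 ω, w ω, y ω)) + d)
    (hD : ∑ t, (H μ (fun ω => (v ω t, z ω t, s1 ω t, s2 ω t)) -
        H μ (fun ω => (z ω t, s1 ω t, s2 ω t))) ≤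
      H μ (fun ω => (v ω, z ω, s1 ω, s2 ω, (k ω, x1 ω, x2 ω, w ω))) -
        H μ (fun ω => (z ω, s1 ω, s2 ω, (k ω, x1 ω, x2 ω, w ω)))) :
    ∑ t, ((H μ (fun ω => (x1 ω t, x2 ω t, w ω t, y ω t)) - H μ (fun ω => w ω t)) +
      (H μ (fun ω => (l ω, v ω, w ω)) - H μ (fun ω => ((x1 ω t, x2 ω t, y ω t), l ω, v ω, w ω)))) ≤
    r + ∑ t, condEnt μ (fun ω => y ω t) (fun ω => (x1 ω t, x2 ω t, w ω t)) +
    ∑ t, CMI μ (fun ω => (s1 ω t, s2 ω t)) (fun ω => v ω t) (fun ω => z ω t) + 2 * d := by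
  have a1 := H_subadd' hμ (fun ω => (x1 ω, x2 ω, y ω, l ω, v ω, w ω))
    (fun ω t => (x1 ω t, x2 ω t, y ω t)) (fun ω => (l ω, v ω, w ω))
    (fun t ω => (l ω, v ω, w ω))
    (by intro ω ω'; simp only [Prod.mk.injEq, funext_iff, forall_and]; tauto)
    (by intro t ω ω'; exact id)
  have a2 := H_subadd0 hμ w
  have a3 := H_subadd' hμ (fun ω => (v ω, z ω)) v z (fun t ω => z ω t)
    (by intro ω ω'; simp only [Prod.mk.injEq])
    (by intro t ω ω' h; rw [h])
  have a4 := H_subadd' hμ (fun ω => (x1 ω, x2 ω, w ω, y ω)) y (fun ω => (x1 ω, x2 ω, w ω))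
    (fun t ω => (x1 ω t, x2 ω t, w ω t))
    (by intro ω ω'; simp only [Prod.mk.injEq]; tauto)
    (by intro t ω ω'; simp only [Prod.mk.injEq]; rintro ⟨h1, h2, h3⟩; simp [h1, h2, h3])
  have e : ∀ t, CMI μ (fun ω => (s1 ω t, s2 ω t)) (fun ω => v ω t) (fun ω => z ω t) =
      (H μ (fun ω => (z ω t, s1 ω t, s2 ω t)) - H μ (fun ω => (v ω t, z ω t, s1 ω t, s2 ω t)))
      + (H μ (fun ω => (v ω t, z ω t)) - H μ (fun ω => z ω t)) := by
    intro t
    unfold CMI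
    rw [H_congr μ (fun ω => ((s1 ω t, s2 ω t), v ω t, z ω t))
        (fun ω => (v ω t, z ω t, s1 ω t, s2 ω t))
        (by intro ω ω'; simp only [Prod.mk.injEq]; tauto),
      H_congr μ (fun ω => ((s1 ω t, s2 ω t), z ω t)) (fun ω => (z ω t, s1 ω t, s2 ω t))
        (by intro ω ω'; simp only [Prod.mk.injEq]; tauto)]
    ring
  have b1 := H_pair_le hμ (fun ω => (l ω, v ω, w ω)) l (fun ω => (v ω, w ω))
    (by intro ω ω'; simp only [Prod.mk.injEq])
  have b2 := H_mono hμ.1 (fun ω => (v ω, w ω, x1 ω, x2 ω, y ω))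
    (fun ω => (x1 ω, x2 ω, y ω, l ω, v ω, w ω))
    (by intro ω ω'; simp only [Prod.mk.injEq]; tauto)
  have b3 := H_submod hμ (fun ω => (v ω, z ω, w ω, x1 ω, x2 ω, y ω)) (fun ω => (v ω, w ω))
    (fun ω => (v ω, w ω, x1 ω, x2 ω, y ω)) (fun ω => (v ω, z ω, w ω))
    (by intro ω ω'; simp only [Prod.mk.injEq]; tauto)
    (by intro ω ω'; simp only [Prod.mk.injEq]; tauto)
    (by intro ω ω'; simp only [Prod.mk.injEq]; tauto)
  have b4 := H_pair_le hμ (fun ω => (v ω, z ω, w ω)) (fun ω => (v ω, z ω)) w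
    (by intro ω ω'; simp only [Prod.mk.injEq]; tauto)
  have b5 := H_submod hμ (fun ω => (z ω, x1 ω, x2 ω, w ω, y ω)) (fun ω => (x1 ω, x2 ω, w ω))
    (fun ω => (x1 ω, x2 ω, w ω, y ω)) (fun ω => (z ω, x1 ω, x2 ω, w ω))
    (by intro ω ω'; simp only [Prod.mk.injEq]; tauto)
    (by intro ω ω'; simp only [Prod.mk.injEq]; tauto)
    (by intro ω ω'; simp only [Prod.mk.injEq]; tauto)
  have b6 := H_mono hμ.1 (fun ω => (v ω, z ω, x1 ω, x2 ω, w ω))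
    (fun ω => (v ω, z ω, w ω, x1 ω, x2 ω, y ω))
    (by intro ω ω'; simp only [Prod.mk.injEq]; tauto)
  have b7 := H_submod hμ (fun ω => (v ω, z ω, s1 ω, s2 ω, (k ω, x1 ω, x2 ω, w ω)))
    (fun ω => (z ω, x1 ω, x2 ω, w ω)) (fun ω => (v ω, z ω, x1 ω, x2 ω, w ω))
    (fun ω => (z ω, s1 ω, s2 ω, (k ω, x1 ω, x2 ω, w ω)))
    (by intro ω ω'; simp only [Prod.mk.injEq]; tauto)
    (by intro ω ω'; simp only [Prod.mk.injEq]; tauto)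
    (by intro ω ω'; simp only [Prod.mk.injEq]; tauto)
  simp only [condEnt, e, Finset.sum_sub_distrib, Finset.sum_add_distrib] at *
  linarith

end Poly

section Kernels

set_option linter.unusedSectionVars false

variable {Ω α β γ ρ σ : Type*} [Fintype Ω] [Fintype α] [Fintype β] [Fintype γ] [Fintype ρ]
  [Fintype σ]

/-- Semidirect product of a pmf and a kernel. -/
def kp (m : α → ℝ) (κ : α → β → ℝ) : α × β → ℝ := fun v => m v.1 * κ v.1 v.2

lemma kp_pmf {m : α → ℝ} {κ : α → β → ℝ} (hm : IsPMF m) (hκ : ∀ a, IsPMF (κ a)) :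
    IsPMF (kp m κ) := by
  refine ⟨fun v => mul_nonneg (hm.1 _) ((hκ _).1 _), ?_⟩
  simp only [kp, Fintype.sum_prod_type, ← Finset.mul_sum, (hκ _).2, mul_one, hm.2]

lemma dist_kp_fst {m : α → ℝ} {κ : α → β → ℝ} (hκ : ∀ a, IsPMF (κ a)) (X : α → γ) :
    dist (kp m κ) (fun v => X v.1) = dist m X := by
  classical
  funext c
  simp only [dist_eq, kp, Fintype.sum_prod_type]
  refine Finset.sum_congr rfl fun a _ => ?_
  split_ifs
  · rw [← Finset.mul_sum, (hκ _).2, mul_one]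
  · simp

lemma H_kp_fst {m : α → ℝ} {κ : α → β → ℝ} (hκ : ∀ a, IsPMF (κ a)) (X : α → γ) :
    H (kp m κ) (fun v => X v.1) = H m X := by
  unfold H
  rw [dist_kp_fst hκ]

/-- Entropy of a pmf in bits. -/
noncomputable def hh (p : β → ℝ) : ℝ := (∑ b, Real.negMulLog (p b)) / Real.log 2

lemma H_eq_hh (μ : Ω → ℝ) (X : Ω → α) : H μ X = hh (dist μ X) := H_eq_nml μ X

lemma H_kernel (μ : Ω → ℝ) (R : Ω → ρ) (G : Ω → γ) (κ : ρ → γ → ℝ)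
    (hκ : ∀ r, IsPMF (κ r))
    (h : ∀ r g, dist μ (fun ω => (R ω, G ω)) (r, g) = dist μ R r * κ r g) :
    H μ (fun ω => (R ω, G ω)) = H μ R + ∑ ω, μ ω * hh (κ (R ω)) := by
  rw [← sum_dist_mul μ R (fun r => hh (κ r)), H_eq_nml, H_eq_nml, Fintype.sum_prod_type]
  simp only [h, Real.negMulLog_mul, Finset.sum_add_distrib, ← Finset.sum_mul, ← Finset.mul_sum,
    (hκ _).2, one_mul, hh]
  rw [add_div]
  congr 1
  rw [Finset.sum_div]
  refine Finset.sum_congr rfl fun r _ => ?_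
  ring

lemma dist_kernel_comp (μ : Ω → ℝ) (R : Ω → ρ) (G : Ω → γ) (φ : ρ → σ) (κ : σ → γ → ℝ)
    (h : ∀ r g, dist μ (fun ω => (R ω, G ω)) (r, g) = dist μ R r * κ (φ r) g) (s : σ) (g : γ) :
    dist μ (fun ω => (φ (R ω), G ω)) (s, g) = dist μ (fun ω => φ (R ω)) s * κ s g := by
  classical
  rw [← dist_dist μ (fun ω => (R ω, G ω)) (fun v => (φ v.1, v.2)), ← dist_dist μ R φ,
    dist_eq, dist_eq, Fintype.sum_prod_type, Finset.sum_mul]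
  refine Finset.sum_congr rfl fun r _ => ?_
  simp only [h, Prod.mk.injEq]
  by_cases h1 : φ r = s <;> simp [h1]

lemma H_kernel_comp (μ : Ω → ℝ) (R : Ω → ρ) (G : Ω → γ) (φ : ρ → σ) (κ : σ → γ → ℝ)
    (hκ : ∀ r, IsPMF (κ r))
    (h : ∀ r g, dist μ (fun ω => (R ω, G ω)) (r, g) = dist μ R r * κ (φ r) g) :
    H μ (fun ω => (φ (R ω), G ω)) - H μ (fun ω => φ (R ω)) =
      ∑ ω, μ ω * hh (κ (φ (R ω))) := by
  rw [H_kernel μ (fun ω => φ (R ω)) G κ hκ (dist_kernel_comp μ R G φ κ h)]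
  ring

/-- Resampling one coordinate of a product distribution. -/
lemma resample {n : ℕ} (p : Fin n → α → ℝ) (t : Fin n) (hp : ∑ a, p t a = 1)
    (c : α) (F : (Fin n → α) → ℝ) :
    p t c * ∑ x : Fin n → α, (∏ i, p i (x i)) * F (Function.update x t c) =
      ∑ x : Fin n → α, (open Classical in if x t = c then (∏ i, p i (x i)) * F x else 0) := by
  classical
  let e := Equiv.funSplitAt t α
  rw [← Equiv.sum_comp e.symm, ← Equiv.sum_comp e.symm]
  have h1 : ∀ (v : α × ({j // j ≠ t} → α)), ∏ i, p i (e.symm v i) =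
      p t v.1 * ∏ j : {j // j ≠ t}, p j (v.2 j) := by
    intro v
    rw [Fintype.prod_eq_mul_prod_subtype_ne _ t]
    congr 1
    · simp [e, Equiv.funSplitAt, Equiv.piSplitAt]
    · refine Finset.prod_congr rfl fun j _ => ?_
      simp [e, Equiv.funSplitAt, Equiv.piSplitAt, j.2]
  have h2 : ∀ (v : α × ({j // j ≠ t} → α)), Function.update (e.symm v) t c = e.symm (c, v.2) := by
    intro v
    funext j
    by_cases hj : j = t
    · subst hj; simp [e, Equiv.funSplitAt, Equiv.piSplitAt]
    · simp [e, Equiv.funSplitAt, Equiv.piSplitAt, hj]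
  have h3 : ∀ (v : α × ({j // j ≠ t} → α)), e.symm v t = v.1 := by
    intro v
    simp [e, Equiv.funSplitAt, Equiv.piSplitAt]
  simp only [h1, h2, h3, Fintype.sum_prod_type]
  rw [Finset.sum_comm]
  have h4 : ∀ r : {j // j ≠ t} → α, ∑ x, p t x * (∏ j : {j // j ≠ t}, p j (r j)) * F (e.symm (c, r)) =
      (∏ j : {j // j ≠ t}, p j (r j)) * F (e.symm (c, r)) := by
    intro r
    simp only [mul_assoc]
    rw [← Finset.sum_mul, hp, one_mul]
  simp only [h4]
  rw [Finset.sum_comm, Finset.mul_sum]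
  refine Finset.sum_congr rfl fun r _ => ?_
  simp [mul_assoc]

/-- Product pmf. -/
def pp {n : ℕ} (p : Fin n → α → ℝ) : (Fin n → α) → ℝ := fun x => ∏ i, p i (x i)

lemma pp_pmf {n : ℕ} {p : Fin n → α → ℝ} (hp : ∀ i, IsPMF (p i)) : IsPMF (pp p) := by
  classical
  refine ⟨fun x => Finset.prod_nonneg fun i _ => (hp i).1 _, ?_⟩
  unfold pp
  have := Finset.prod_univ_sum (fun _ : Fin n => (Finset.univ : Finset α)) p
  rw [Fintype.piFinset_univ] at this
  rw [← this]
  simp [(hp _).2]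

lemma dist_pp {n : ℕ} {p : Fin n → α → ℝ} (hp : ∀ i, IsPMF (p i)) (t : Fin n) :
    dist (pp p) (fun x => x t) = p t := by
  classical
  funext c
  have := resample p t (hp t).2 c (fun _ => 1)
  simp only [mul_one] at this
  have h := (pp_pmf hp).2
  unfold pp at h
  rw [h, mul_one] at this
  rw [this, dist_eq]
  unfold pp
  refine Finset.sum_congr rfl fun x _ => ?_
  congr

lemma hh_pp {n : ℕ} {p : Fin n → α → ℝ} (hp : ∀ i, IsPMF (p i)) :
    hh (pp p) = ∑ i, hh (p i) := by
  unfold hh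
  rw [← Finset.sum_div]
  congr 1
  induction n with
  | zero => simp [pp]
  | succ n ih =>
    rw [← Equiv.sum_comp (Fin.consEquiv (fun _ => α)), Fintype.sum_prod_type, Fin.sum_univ_succ]
    have ih' := ih (p := fun i => p i.succ) (fun i => hp _)
    have h := (pp_pmf (p := fun i : Fin n => p i.succ) (fun i => hp _)).2
    have h2 : ∀ x : α, ∀ y : Fin n → α, pp p (Fin.consEquiv (fun _ => α) (x, y)) =
        p 0 x * pp (fun i : Fin n => p i.succ) y := by
      intro x y
      simp [pp, Fin.prod_univ_succ, Fin.consEquiv]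
    simp only [h2, Real.negMulLog_mul, Finset.sum_add_distrib, ← Finset.sum_mul, ← Finset.mul_sum,
      h, (hp 0).2, ih', one_mul]

/-- Mixing over a uniform time index. -/
lemma H_mix {Ω' τ : Type*} [Fintype Ω'] [Fintype τ] {n : ℕ} (hn : 0 < n) (μ : Ω' → ℝ)
    (T : Ω' → Fin n)
    (s : Ω' → τ) {M : Ω → ℝ} (hM : IsPMF M) (st : Fin n → Ω → τ)
    (h : ∀ a t, dist μ (fun ω => (s ω, T ω)) (a, t) = 1 / (n : ℝ) * dist M (st t) a)
    (A : τ → α) :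
    H μ (fun ω => (A (s ω), T ω)) = Real.logb 2 n + 1 / (n : ℝ) * ∑ t, H M (fun ω => A (st t ω)) := by
  classical
  have h1 : ∀ a t, dist μ (fun ω => (A (s ω), T ω)) (a, t) =
      1 / (n : ℝ) * dist M (fun ω => A (st t ω)) a := by
    intro a t
    rw [← dist_dist μ (fun ω => (s ω, T ω)) (fun v => (A v.1, v.2)), ← dist_dist M (st t) A,
      dist_eq, dist_eq, Fintype.sum_prod_type, Finset.mul_sum]
    refine Finset.sum_congr rfl fun r _ => ?_
    simp only [h, Prod.mk.injEq]
    by_cases h1 : A r = a <;> simp [h1]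
  have hn' : (n : ℝ) ≠ 0 := by positivity
  rw [H_eq_nml, Fintype.sum_prod_type]
  simp only [h1, Real.negMulLog_mul, Finset.sum_add_distrib]
  rw [Finset.sum_comm]
  simp only [← Finset.sum_mul, sum_dist, hM.2]
  rw [Finset.sum_comm]
  simp only [H_eq_nml, ← Finset.sum_div, ← Finset.mul_sum]
  simp [Real.negMulLog, Real.logb]
  field_simp

lemma CMI_congr {α' β' γ' : Type*} [Fintype α'] [Fintype β'] [Fintype γ'] (μ : Ω → ℝ)
    (X : Ω → α) (Y : Ω → β) (Z : Ω → γ) (X' : Ω → α') (Y' : Ω → β') (Z' : Ω → γ')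
    (hX : ∀ ω ω', X ω = X ω' ↔ X' ω = X' ω') (hY : ∀ ω ω', Y ω = Y ω' ↔ Y' ω = Y' ω')
    (hZ : ∀ ω ω', Z ω = Z ω' ↔ Z' ω = Z' ω') : CMI μ X Y Z = CMI μ X' Y' Z' := by
  unfold CMI
  rw [H_congr μ (fun ω => (X ω, Z ω)) (fun ω => (X' ω, Z' ω)) (by simp [hX, hZ]),
    H_congr μ (fun ω => (Y ω, Z ω)) (fun ω => (Y' ω, Z' ω)) (by simp [hY, hZ]),
    H_congr μ (fun ω => (X ω, Y ω, Z ω)) (fun ω => (X' ω, Y' ω, Z' ω)) (by simp [hX, hY, hZ]),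
    H_congr μ Z Z' hZ]

lemma CMI_mix {Ω' τ : Type*} [Fintype Ω'] [Fintype τ] {n : ℕ} (hn : 0 < n) (μ : Ω' → ℝ)
    (T : Ω' → Fin n)
    (s : Ω' → τ) {M : Ω → ℝ} (hM : IsPMF M) (st : Fin n → Ω → τ)
    (h : ∀ a t, dist μ (fun ω => (s ω, T ω)) (a, t) = 1 / (n : ℝ) * dist M (st t) a)
    (A : τ → α) (B : τ → β) (C : τ → γ) :
    CMI μ (fun ω => A (s ω)) (fun ω => B (s ω)) (fun ω => (C (s ω), T ω)) =
      1 / (n : ℝ) * ∑ t, CMI M (fun ω => A (st t ω)) (fun ω => B (st t ω)) (fun ω => C (st t ω)) := by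
  unfold CMI
  rw [H_congr μ (fun ω => (A (s ω), C (s ω), T ω)) (fun ω => ((A (s ω), C (s ω)), T ω))
      (by intro ω ω'; simp only [Prod.mk.injEq]; tauto),
    H_congr μ (fun ω => (B (s ω), C (s ω), T ω)) (fun ω => ((B (s ω), C (s ω)), T ω))
      (by intro ω ω'; simp only [Prod.mk.injEq]; tauto),
    H_congr μ (fun ω => (A (s ω), B (s ω), C (s ω), T ω))
      (fun ω => ((A (s ω), B (s ω), C (s ω)), T ω))
      (by intro ω ω'; simp only [Prod.mk.injEq]; tauto),
    H_mix hn μ T s hM st h (fun v => (A v, C v)), H_mix hn μ T s hM st h (fun v => (B v, C v)),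
    H_mix hn μ T s hM st h (fun v => (A v, B v, C v)), H_mix hn μ T s hM st h C]
  simp only [Finset.sum_sub_distrib, Finset.sum_add_distrib]
  ring

lemma condEnt_mix {Ω' τ : Type*} [Fintype Ω'] [Fintype τ] {n : ℕ} (hn : 0 < n) (μ : Ω' → ℝ)
    (T : Ω' → Fin n)
    (s : Ω' → τ) {M : Ω → ℝ} (hM : IsPMF M) (st : Fin n → Ω → τ)
    (h : ∀ a t, dist μ (fun ω => (s ω, T ω)) (a, t) = 1 / (n : ℝ) * dist M (st t) a)
    (A : τ → α) (C : τ → γ) :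
    condEnt μ (fun ω => A (s ω)) (fun ω => (C (s ω), T ω)) =
      1 / (n : ℝ) * ∑ t, condEnt M (fun ω => A (st t ω)) (fun ω => C (st t ω)) := by
  unfold condEnt
  rw [H_congr μ (fun ω => (A (s ω), C (s ω), T ω)) (fun ω => ((A (s ω), C (s ω)), T ω))
      (by intro ω ω'; simp only [Prod.mk.injEq]; tauto),
    H_mix hn μ T s hM st h (fun v => (A v, C v)), H_mix hn μ T s hM st h C]
  simp only [Finset.sum_sub_distrib]
  ring

/-- Continuity modulus. -/
noncomputable def modu (N τ : ℝ) : ℝ := (τ * (Real.log N + 1) + Real.negMulLog τ) / Real.log 2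

lemma hh_cont (p q : α → ℝ) (hp : IsPMF p) (hq : IsPMF q) (n : ℕ) (hn : 0 < n) (N : ℕ)
    (hN : Fintype.card α ≤ N ^ n) (hT : TV p q ≤ 1) :
    hh p ≤ hh q + n * modu N (TV p q) := by
  have hl2 : 0 < Real.log 2 := Real.log_pos (by norm_num)
  have h := nml_cont p q hp hq
  have h0 := TV_nonneg p q
  have hne : 0 < Fintype.card α := by
    rw [Fintype.card_pos_iff]
    by_contra hc
    rw [not_nonempty_iff] at hc
    have := hp.2
    simp at this
  have h1 : Real.log (Fintype.card α) ≤ n * Real.log N := by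
    rw [← Real.log_pow]
    refine Real.log_le_log (by exact_mod_cast hne) (by exact_mod_cast hN)
  have h2 := Real.negMulLog_nonneg h0 hT
  have hn1 : (1 : ℝ) ≤ n := by exact_mod_cast hn
  unfold hh modu
  rw [mul_div_assoc', ← add_div]
  gcongr
  refine h.trans ?_
  have h3 : TV p q * (Real.log (Fintype.card α) + 1) ≤ n * (TV p q * (Real.log N + 1)) := by
    nlinarith
  nlinarith

lemma modu_tendsto (N : ℝ) : Filter.Tendsto (modu N) (nhds 0) (nhds 0) := by
  have h : Continuous (modu N) := by
    unfold modu
    have := Real.continuous_negMulLog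
    fun_prop
  have := h.tendsto 0
  simpa [modu] using this

end Kernels

section Model

set_option linter.unusedSectionVars false

section Gen

variable {Ω α β γ δ : Type*} [Fintype Ω] [Fintype α] [Fintype β] [Fintype γ] [Fintype δ]

lemma dist_congr_event (μ : Ω → ℝ) (X : Ω → α) (X' : Ω → β) (a : α) (b : β)
    (h : ∀ ω, X ω = a ↔ X' ω = b) : dist μ X a = dist μ X' b := by
  classical
  rw [dist_eq, dist_eq]
  simp only [h]

lemma dist_equiv (μ : Ω → ℝ) (e : Ω ≃ α) (a : α) : dist μ (fun ω => e ω) a = μ (e.symm a) := by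
  classical
  rw [dist_eq, Finset.sum_eq_single (e.symm a)]
  · simp
  · intro b _ hb
    rw [if_neg]
    rintro rfl
    simp at hb
  · simp

lemma dist_kp_cond (m : α → ℝ) (κ : α → β → ℝ) (f : α → γ) (g : β → δ) (a : γ) (b : δ) (c : ℝ)
    (h : ∀ r, f r = a → dist (κ r) g b = c) :
    dist (kp m κ) (fun v => (f v.1, g v.2)) (a, b) = dist m f a * c := by
  classical
  rw [dist_eq, dist_eq, Fintype.sum_prod_type, Finset.sum_mul]
  refine Finset.sum_congr rfl fun r _ => ?_
  by_cases h1 : f r = a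
  · rw [if_pos h1, ← h r h1, dist_eq, Finset.mul_sum]
    refine Finset.sum_congr rfl fun s _ => ?_
    simp [h1, kp]
  · simp [h1]

lemma dist_kp_self (m : α → ℝ) (κ : α → β → ℝ) (g : β → δ) (r : α) (b : δ) :
    dist (kp m κ) (fun v => (v.1, g v.2)) (r, b) = m r * dist (κ r) g b := by
  rw [dist_kp_cond m κ (fun r => r) g r b (dist (κ r) g b) (by rintro _ rfl; rfl), dist_id]

lemma dist_kp_self' (m : α → ℝ) (κ : α → β → ℝ) (hκ : ∀ a, IsPMF (κ a)) (g : β → δ) (r : α) (b : δ) :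
    dist (kp m κ) (fun v => (v.1, g v.2)) (r, b) =
      dist (kp m κ) (fun v => v.1) r * dist (κ r) g b := by
  rw [dist_kp_self, dist_kp_fst hκ (fun a => a), dist_id]

lemma dist_kp_const_snd (m : α → ℝ) (hm : IsPMF m) (κ : β → ℝ) :
    dist (kp m (fun _ => κ)) (fun v => v.2) = κ := by
  classical
  funext b
  rw [dist_eq, Fintype.sum_prod_type]
  simp [kp, ← Finset.sum_mul, hm.2]

lemma hh_kp_const (m : α → ℝ) (hm : IsPMF m) (κ : β → ℝ) (hκ : IsPMF κ) :
    hh (kp m (fun _ => κ)) = hh m + hh κ := by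
  unfold hh
  rw [Fintype.sum_prod_type]
  simp only [kp, Real.negMulLog_mul, Finset.sum_add_distrib, ← Finset.sum_mul, ← Finset.mul_sum,
    hm.2, hκ.2, one_mul]
  rw [add_div]

lemma pmf_nonempty {p : α → ℝ} (h : IsPMF p) : Nonempty α := by
  by_contra hc
  rw [not_nonempty_iff] at hc
  have := h.2
  simp at this

end Gen

/-- Source marginal of the target. -/
def srcP (q : X1 × X2 × W × Y → ℝ) : X1 × X2 × W → ℝ :=
  fun d => ∑ y', q (d.1, d.2.1, d.2.2, y')

lemma srcP_pmf {q : X1 × X2 × W × Y → ℝ} (hq : IsPMF q) : IsPMF (srcP q) := by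
  refine ⟨fun d => Finset.sum_nonneg fun y _ => hq.1 _, ?_⟩
  have := hq.2
  simp only [Fintype.sum_prod_type] at this
  simpa only [srcP, Fintype.sum_prod_type] using this

abbrev KK (k1 k2 : ℕ) := Fin k1 × Fin k2
abbrev O1 (X1 X2 W : Type) (n k1 k2 : ℕ) := (Fin n → X1 × X2 × W) × KK k1 k2
abbrev SS (Xt1 Xt2 : Type) (n : ℕ) := (Fin n → Xt1) × (Fin n → Xt2)
abbrev O2 (X1 X2 W Xt1 Xt2 : Type) (n k1 k2 : ℕ) := O1 X1 X2 W n k1 k2 × SS Xt1 Xt2 n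
abbrev O3 (X1 X2 W Xt1 Xt2 Yt Zt : Type) (n k1 k2 : ℕ) :=
  O2 X1 X2 W Xt1 Xt2 n k1 k2 × (Fin n → Yt × Zt)
abbrev O4 (X1 X2 W Y Xt1 Xt2 Yt Zt : Type) (n k1 k2 : ℕ) :=
  O3 X1 X2 W Xt1 Xt2 Yt Zt n k1 k2 × (Fin n → Y)

variable {n k1 k2 : ℕ}

noncomputable def unifK (k1 k2 : ℕ) : KK k1 k2 → ℝ := fun _ => 1 / ((k1 : ℝ) * (k2 : ℝ))

lemma unifK_pmf (h1 : 1 ≤ k1) (h2 : 1 ≤ k2) : IsPMF (unifK k1 k2) := by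
  have h1' : (k1 : ℝ) ≠ 0 := by positivity
  have h2' : (k2 : ℝ) ≠ 0 := by positivity
  refine ⟨fun _ => by unfold unifK; positivity, ?_⟩
  simp [unifK]
  field_simp

noncomputable def m1 (q : X1 × X2 × W × Y → ℝ) (n k1 k2 : ℕ) : O1 X1 X2 W n k1 k2 → ℝ :=
  kp (pp (fun _ : Fin n => srcP q)) (fun _ => unifK k1 k2)

noncomputable def m2 (q : X1 × X2 × W × Y → ℝ)
    (e : (Fin n → X1 × X2 × W) → KK k1 k2 → SS Xt1 Xt2 n → ℝ) : O2 X1 X2 W Xt1 Xt2 n k1 k2 → ℝ :=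
  kp (m1 q n k1 k2) (fun r s => e r.1 r.2 s)

noncomputable def m3 (q : X1 × X2 × W × Y → ℝ) (ch : Xt1 × Xt2 → Yt × Zt → ℝ)
    (e : (Fin n → X1 × X2 × W) → KK k1 k2 → SS Xt1 Xt2 n → ℝ) :
    O3 X1 X2 W Xt1 Xt2 Yt Zt n k1 k2 → ℝ :=
  kp (m2 q e) (fun r => pp (fun i => ch (r.2.1 i, r.2.2 i)))

noncomputable def m4 (q : X1 × X2 × W × Y → ℝ) (ch : Xt1 × Xt2 → Yt × Zt → ℝ)
    (e : (Fin n → X1 × X2 × W) → KK k1 k2 → SS Xt1 Xt2 n → ℝ)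
    (dc : KK k1 k2 → (Fin n → W) → (Fin n → Yt) → (Fin n → Y) → ℝ) :
    O4 X1 X2 W Y Xt1 Xt2 Yt Zt n k1 k2 → ℝ :=
  kp (m3 q ch e) (fun r => dc r.1.1.2 (fun i => (r.1.1.1 i).2.2) (fun i => (r.2 i).1))

/-- The pair of encoders of a code as one kernel. -/
def encC (C : Code X1 X2 W Y Xt1 Xt2 Yt n k1 k2) :
    (Fin n → X1 × X2 × W) → KK k1 k2 → SS Xt1 Xt2 n → ℝ :=
  fun x k s => C.enc1 (fun i => (x i).1) k.1 s.1 * C.enc2 (fun i => (x i).2.1) k.2 s.2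

/-- Encoders with the `t`-th source symbols overwritten. -/
def encU (C : Code X1 X2 W Y Xt1 Xt2 Yt n k1 k2) (t : Fin n) (x1 : X1) (x2 : X2) :
    (Fin n → X1 × X2 × W) → KK k1 k2 → SS Xt1 Xt2 n → ℝ :=
  fun x k s => C.enc1 (Function.update (fun i => (x i).1) t x1) k.1 s.1 *
    C.enc2 (Function.update (fun i => (x i).2.1) t x2) k.2 s.2

def decC (C : Code X1 X2 W Y Xt1 Xt2 Yt n k1 k2) :
    KK k1 k2 → (Fin n → W) → (Fin n → Yt) → (Fin n → Y) → ℝ :=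
  fun k w v => C.dec k.1 k.2 w v

lemma prod_pmf {α β : Type*} [Fintype α] [Fintype β] {p : α → ℝ} {r : β → ℝ} (hp : IsPMF p)
    (hr : IsPMF r) : IsPMF (fun s : α × β => p s.1 * r s.2) :=
  kp_pmf (κ := fun _ => r) hp (fun _ => hr)

lemma encC_pmf (C : Code X1 X2 W Y Xt1 Xt2 Yt n k1 k2) (x k) : IsPMF (encC C x k) :=
  prod_pmf (C.enc1_pmf _ _) (C.enc2_pmf _ _)

lemma encU_pmf (C : Code X1 X2 W Y Xt1 Xt2 Yt n k1 k2) (t x1 x2) (x k) :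
    IsPMF (encU C t x1 x2 x k) :=
  prod_pmf (C.enc1_pmf _ _) (C.enc2_pmf _ _)

lemma decC_pmf (C : Code X1 X2 W Y Xt1 Xt2 Yt n k1 k2) (k w v) : IsPMF (decC C k w v) :=
  C.dec_pmf _ _ _ _

lemma m1_pmf {q : X1 × X2 × W × Y → ℝ} (hq : IsPMF q) (h1 : 1 ≤ k1) (h2 : 1 ≤ k2) :
    IsPMF (m1 q n k1 k2) :=
  kp_pmf (pp_pmf fun _ => srcP_pmf hq) (fun _ => unifK_pmf h1 h2)

lemma m2_pmf {q : X1 × X2 × W × Y → ℝ} (hq : IsPMF q) (h1 : 1 ≤ k1) (h2 : 1 ≤ k2)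
    {e : (Fin n → X1 × X2 × W) → KK k1 k2 → SS Xt1 Xt2 n → ℝ} (he : ∀ x k, IsPMF (e x k)) :
    IsPMF (m2 q e) :=
  kp_pmf (m1_pmf hq h1 h2) (fun _ => he _ _)

lemma m3_pmf {q : X1 × X2 × W × Y → ℝ} (hq : IsPMF q) (h1 : 1 ≤ k1) (h2 : 1 ≤ k2)
    {ch : Xt1 × Xt2 → Yt × Zt → ℝ} (hch : ∀ x, IsPMF (ch x))
    {e : (Fin n → X1 × X2 × W) → KK k1 k2 → SS Xt1 Xt2 n → ℝ} (he : ∀ x k, IsPMF (e x k)) :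
    IsPMF (m3 q ch e) :=
  kp_pmf (m2_pmf hq h1 h2 he) (fun _ => pp_pmf fun _ => hch _)

lemma m4_pmf {q : X1 × X2 × W × Y → ℝ} (hq : IsPMF q) (h1 : 1 ≤ k1) (h2 : 1 ≤ k2)
    {ch : Xt1 × Xt2 → Yt × Zt → ℝ} (hch : ∀ x, IsPMF (ch x))
    {e : (Fin n → X1 × X2 × W) → KK k1 k2 → SS Xt1 Xt2 n → ℝ} (he : ∀ x k, IsPMF (e x k))
    {dc : KK k1 k2 → (Fin n → W) → (Fin n → Yt) → (Fin n → Y) → ℝ}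
    (hdc : ∀ k w v, IsPMF (dc k w v)) :
    IsPMF (m4 q ch e dc) :=
  kp_pmf (m3_pmf hq h1 h2 hch he) (fun _ => hdc _ _ _)

/-! Random variables on the block sample space. -/

def vX1 : O4 X1 X2 W Y Xt1 Xt2 Yt Zt n k1 k2 → Fin n → X1 := fun ω i => (ω.1.1.1.1 i).1
def vX2 : O4 X1 X2 W Y Xt1 Xt2 Yt Zt n k1 k2 → Fin n → X2 := fun ω i => (ω.1.1.1.1 i).2.1
def vW : O4 X1 X2 W Y Xt1 Xt2 Yt Zt n k1 k2 → Fin n → W := fun ω i => (ω.1.1.1.1 i).2.2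
def vK : O4 X1 X2 W Y Xt1 Xt2 Yt Zt n k1 k2 → KK k1 k2 := fun ω => ω.1.1.1.2
def vS1 : O4 X1 X2 W Y Xt1 Xt2 Yt Zt n k1 k2 → Fin n → Xt1 := fun ω => ω.1.1.2.1
def vS2 : O4 X1 X2 W Y Xt1 Xt2 Yt Zt n k1 k2 → Fin n → Xt2 := fun ω => ω.1.1.2.2
def vV : O4 X1 X2 W Y Xt1 Xt2 Yt Zt n k1 k2 → Fin n → Yt := fun ω i => (ω.1.2 i).1
def vZ : O4 X1 X2 W Y Xt1 Xt2 Yt Zt n k1 k2 → Fin n → Zt := fun ω i => (ω.1.2 i).2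
def vY : O4 X1 X2 W Y Xt1 Xt2 Yt Zt n k1 k2 → Fin n → Y := fun ω => ω.2

section Facts

variable {q : X1 × X2 × W × Y → ℝ} (hq : IsPMF q) (h1 : 1 ≤ k1) (h2 : 1 ≤ k2)
    {ch : Xt1 × Xt2 → Yt × Zt → ℝ} (hch : ∀ x, IsPMF (ch x))
    (C : Code X1 X2 W Y Xt1 Xt2 Yt n k1 k2)

/-- Reduction to the first prefix. -/
lemma H_red1 {q : X1 × X2 × W × Y → ℝ}
    {ch : Xt1 × Xt2 → Yt × Zt → ℝ} (hch : ∀ x, IsPMF (ch x))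
    (C : Code X1 X2 W Y Xt1 Xt2 Yt n k1 k2)
    {γ : Type*} [Fintype γ] (f : O1 X1 X2 W n k1 k2 → γ) :
    H (m4 q ch (encC C) (decC C)) (fun ω => f ω.1.1.1) = H (m1 q n k1 k2) f := by
  unfold m4 m3 m2
  refine (H_kp_fst (fun r => decC_pmf C _ _ _)
    (fun ω : O3 X1 X2 W Xt1 Xt2 Yt Zt n k1 k2 => f ω.1.1)).trans ?_
  refine (H_kp_fst (fun r => pp_pmf fun _ => hch _)
    (fun ω : O2 X1 X2 W Xt1 Xt2 n k1 k2 => f ω.1)).trans ?_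
  exact H_kp_fst (fun r => encC_pmf C _ _) f

lemma H_red2 {q : X1 × X2 × W × Y → ℝ}
    {ch : Xt1 × Xt2 → Yt × Zt → ℝ} (hch : ∀ x, IsPMF (ch x))
    (C : Code X1 X2 W Y Xt1 Xt2 Yt n k1 k2)
    {γ : Type*} [Fintype γ] (f : O2 X1 X2 W Xt1 Xt2 n k1 k2 → γ) :
    H (m4 q ch (encC C) (decC C)) (fun ω => f ω.1.1) = H (m2 q (encC C)) f := by
  unfold m4 m3
  refine (H_kp_fst (fun r => decC_pmf C _ _ _)
    (fun ω : O3 X1 X2 W Xt1 Xt2 Yt Zt n k1 k2 => f ω.1)).trans ?_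
  exact H_kp_fst (fun r => pp_pmf fun _ => hch _) f

lemma H_red3 {q : X1 × X2 × W × Y → ℝ}
    {ch : Xt1 × Xt2 → Yt × Zt → ℝ}
    (C : Code X1 X2 W Y Xt1 Xt2 Yt n k1 k2)
    {γ : Type*} [Fintype γ] (f : O3 X1 X2 W Xt1 Xt2 Yt Zt n k1 k2 → γ) :
    H (m4 q ch (encC C) (decC C)) (fun ω => f ω.1) = H (m3 q ch (encC C)) f := by
  unfold m4
  rw [H_kp_fst (fun r => decC_pmf C _ _ _) f]

lemma H_src {q : X1 × X2 × W × Y → ℝ} (h1 : 1 ≤ k1) (h2 : 1 ≤ k2)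
    {γ : Type*} [Fintype γ] (f : (Fin n → X1 × X2 × W) → γ) :
    H (m1 q n k1 k2) (fun ω => f ω.1) = H (pp (fun _ : Fin n => srcP q)) f := by
  unfold m1
  rw [H_kp_fst (fun r => unifK_pmf h1 h2) f]

include hq h1 h2 hch in
lemma factB : ∑ t, H (m4 q ch (encC C) (decC C)) (fun ω => (vX1 ω t, vX2 ω t, vW ω t)) ≤
    H (m4 q ch (encC C) (decC C)) (fun ω => (vX1 ω, vX2 ω, vW ω)) := by
  have e1 : H (m4 q ch (encC C) (decC C)) (fun ω => (vX1 ω, vX2 ω, vW ω)) =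
      n * hh (srcP q) := by
    rw [H_congr _ (fun ω => (vX1 ω, vX2 ω, vW ω)) (fun ω => ω.1.1.1.1)
      (by intro ω ω'; simp only [vX1, vX2, vW, Prod.mk.injEq, funext_iff, Prod.ext_iff, forall_and]),
      H_red1 hch C (fun r => r.1), H_src h1 h2 (fun x => x), H_eq_hh, dist_id,
      hh_pp (fun _ => srcP_pmf hq)]
    simp
  have e2 : ∀ t, H (m4 q ch (encC C) (decC C)) (fun ω => (vX1 ω t, vX2 ω t, vW ω t)) =
      hh (srcP q) := by
    intro t
    have : (fun ω : O4 X1 X2 W Y Xt1 Xt2 Yt Zt n k1 k2 => (vX1 ω t, vX2 ω t, vW ω t)) =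
      (fun ω => ω.1.1.1.1 t) := rfl
    rw [this, H_red1 hch C (fun r => r.1 t), H_src h1 h2 (fun x => x t), H_eq_hh,
      dist_pp (fun _ => srcP_pmf hq)]
  simp [e1, e2]

include hq h1 h2 hch in
lemma factA : H (m4 q ch (encC C) (decC C)) vK +
      H (m4 q ch (encC C) (decC C)) (fun ω => (vX1 ω, vX2 ω, vW ω)) ≤
    H (m4 q ch (encC C) (decC C)) (fun ω => (vK ω, vX1 ω, vX2 ω, vW ω)) := by
  have e1 : H (m4 q ch (encC C) (decC C)) (fun ω => (vX1 ω, vX2 ω, vW ω)) =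
      hh (pp (fun _ : Fin n => srcP q)) := by
    rw [H_congr _ (fun ω => (vX1 ω, vX2 ω, vW ω)) (fun ω => ω.1.1.1.1)
      (by intro ω ω'; simp only [vX1, vX2, vW, Prod.mk.injEq, funext_iff, Prod.ext_iff, forall_and]),
      H_red1 hch C (fun r => r.1), H_src h1 h2 (fun x => x), H_eq_hh, dist_id]
  have e2 : H (m4 q ch (encC C) (decC C)) vK = hh (unifK k1 k2) := by
    have := H_red1 (q := q) hch C (fun r => r.2)
    have e : (vK : O4 X1 X2 W Y Xt1 Xt2 Yt Zt n k1 k2 → KK k1 k2) = fun ω => ω.1.1.1.2 := rfl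
    rw [e, this, H_eq_hh]
    unfold m1
    rw [dist_kp_const_snd _ (pp_pmf fun _ => srcP_pmf hq)]
  have e3 : H (m4 q ch (encC C) (decC C)) (fun ω => (vK ω, vX1 ω, vX2 ω, vW ω)) =
      hh (pp (fun _ : Fin n => srcP q)) + hh (unifK k1 k2) := by
    rw [H_congr _ (fun ω => (vK ω, vX1 ω, vX2 ω, vW ω)) (fun ω => ω.1.1.1)
      (by
        intro ω ω'
        simp only [vK, vX1, vX2, vW, Prod.mk.injEq, funext_iff, Prod.ext_iff, forall_and]
        tauto),
      H_red1 hch C (fun r => r), H_eq_hh, dist_id]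
    unfold m1
    rw [hh_kp_const _ (pp_pmf fun _ => srcP_pmf hq) _ (unifK_pmf h1 h2)]
  rw [e1, e2, e3]
  linarith

include hch in
lemma factC1 : H (m4 q ch (encC C) (decC C)) (fun ω => (vK ω, vX1 ω, vX2 ω, vW ω)) +
      H (m4 q ch (encC C) (decC C)) (fun ω => (vS2 ω, vK ω, vX2 ω, vW ω)) ≤
    H (m4 q ch (encC C) (decC C)) (fun ω => (vS2 ω, vK ω, vX1 ω, vX2 ω, vW ω)) +
      H (m4 q ch (encC C) (decC C)) (fun ω => (vK ω, vX2 ω, vW ω)) := by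
  have hd : ∀ (r : O1 X1 X2 W n k1 k2) (g : Fin n → Xt2),
      dist (m2 q (encC C)) (fun ω => (ω.1, ω.2.2)) (r, g) =
      dist (m2 q (encC C)) (fun ω => ω.1) r * C.enc2 (fun i => (r.1 i).2.1) r.2.2 g := by
    intro r g
    unfold m2
    rw [dist_kp_self' _ _ (fun _ => encC_pmf C _ _) (fun s => s.2)]
    congr 1
    have := dist_kp_const_snd _ (C.enc1_pmf (fun i => (r.1 i).1) r.2.1)
      (C.enc2 (fun i => (r.1 i).2.1) r.2.2)
    exact congrFun this g
  have a := H_kernel_comp (m2 q (encC C)) (fun ω => ω.1) (fun ω => ω.2.2)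
    (fun r => r) (fun r g => C.enc2 (fun i => (r.1 i).2.1) r.2.2 g) (fun _ => C.enc2_pmf _ _) hd
  have b := H_kernel_comp (m2 q (encC C)) (fun ω => ω.1) (fun ω => ω.2.2)
    (fun r => (r.2, (fun i => (r.1 i).2.1), (fun i => (r.1 i).2.2)))
    (fun r g => C.enc2 r.2.1 r.1.2 g) (fun _ => C.enc2_pmf _ _) hd
  rw [← H_red2 hch C, ← H_red2 hch C] at a b
  have c1 : H (m4 q ch (encC C) (decC C)) (fun ω => (vK ω, vX1 ω, vX2 ω, vW ω)) =
      H (m4 q ch (encC C) (decC C)) (fun ω => ω.1.1.1) :=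
    H_congr _ _ _ (by
        intro ω ω'
        simp only [vK, vX1, vX2, vW, Prod.mk.injEq, funext_iff, Prod.ext_iff, forall_and]
        tauto)
  have c2 : H (m4 q ch (encC C) (decC C)) (fun ω => (vS2 ω, vK ω, vX1 ω, vX2 ω, vW ω)) =
      H (m4 q ch (encC C) (decC C)) (fun ω => (ω.1.1.1, ω.1.1.2.2)) :=
    H_congr _ _ _ (by
        intro ω ω'
        simp only [vS2, vK, vX1, vX2, vW, Prod.mk.injEq, funext_iff, Prod.ext_iff, forall_and]
        tauto)
  have c3 : H (m4 q ch (encC C) (decC C)) (fun ω => (vS2 ω, vK ω, vX2 ω, vW ω)) =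
      H (m4 q ch (encC C) (decC C)) (fun ω => ((ω.1.1.1.2, (fun i => (ω.1.1.1.1 i).2.1),
        (fun i => (ω.1.1.1.1 i).2.2)), ω.1.1.2.2)) :=
    H_congr _ _ _ (by
        intro ω ω'
        simp only [vS2, vK, vX2, vW, Prod.mk.injEq]
        tauto)
  have c4 : H (m4 q ch (encC C) (decC C)) (fun ω => (vK ω, vX2 ω, vW ω)) =
      H (m4 q ch (encC C) (decC C)) (fun ω => (ω.1.1.1.2, (fun i => (ω.1.1.1.1 i).2.1),
        (fun i => (ω.1.1.1.1 i).2.2))) := rfl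
  rw [c1, c2, c3, c4]
  linarith

include hch in
lemma factC2 : H (m4 q ch (encC C) (decC C)) (fun ω => (vK ω, vX2 ω, vX1 ω, vW ω)) +
      H (m4 q ch (encC C) (decC C)) (fun ω => (vS1 ω, vK ω, vX1 ω, vW ω)) ≤
    H (m4 q ch (encC C) (decC C)) (fun ω => (vS1 ω, vK ω, vX2 ω, vX1 ω, vW ω)) +
      H (m4 q ch (encC C) (decC C)) (fun ω => (vK ω, vX1 ω, vW ω)) := by
  have hd : ∀ (r : O1 X1 X2 W n k1 k2) (g : Fin n → Xt1),
      dist (m2 q (encC C)) (fun ω => (ω.1, ω.2.1)) (r, g) =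
      dist (m2 q (encC C)) (fun ω => ω.1) r * C.enc1 (fun i => (r.1 i).1) r.2.1 g := by
    intro r g
    unfold m2
    rw [dist_kp_self' _ _ (fun _ => encC_pmf C _ _) (fun s => s.1)]
    congr 1
    have := dist_kp_fst (m := C.enc1 (fun i => (r.1 i).1) r.2.1)
      (κ := fun _ => C.enc2 (fun i => (r.1 i).2.1) r.2.2) (fun _ => C.enc2_pmf _ _) (fun s => s)
    rw [dist_id] at this
    exact congrFun this g
  have a := H_kernel_comp (m2 q (encC C)) (fun ω => ω.1) (fun ω => ω.2.1)
    (fun r => r) (fun r g => C.enc1 (fun i => (r.1 i).1) r.2.1 g) (fun _ => C.enc1_pmf _ _) hd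
  have b := H_kernel_comp (m2 q (encC C)) (fun ω => ω.1) (fun ω => ω.2.1)
    (fun r => (r.2, (fun i => (r.1 i).1), (fun i => (r.1 i).2.2)))
    (fun r g => C.enc1 r.2.1 r.1.1 g) (fun _ => C.enc1_pmf _ _) hd
  rw [← H_red2 hch C, ← H_red2 hch C] at a b
  have c1 : H (m4 q ch (encC C) (decC C)) (fun ω => (vK ω, vX2 ω, vX1 ω, vW ω)) =
      H (m4 q ch (encC C) (decC C)) (fun ω => ω.1.1.1) :=
    H_congr _ _ _ (by
        intro ω ω'
        simp only [vK, vX1, vX2, vW, Prod.mk.injEq, funext_iff, Prod.ext_iff, forall_and]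
        tauto)
  have c2 : H (m4 q ch (encC C) (decC C)) (fun ω => (vS1 ω, vK ω, vX2 ω, vX1 ω, vW ω)) =
      H (m4 q ch (encC C) (decC C)) (fun ω => (ω.1.1.1, ω.1.1.2.1)) :=
    H_congr _ _ _ (by
        intro ω ω'
        simp only [vS1, vK, vX1, vX2, vW, Prod.mk.injEq, funext_iff, Prod.ext_iff, forall_and]
        tauto)
  have c3 : H (m4 q ch (encC C) (decC C)) (fun ω => (vS1 ω, vK ω, vX1 ω, vW ω)) =
      H (m4 q ch (encC C) (decC C)) (fun ω => ((ω.1.1.1.2, (fun i => (ω.1.1.1.1 i).1),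
        (fun i => (ω.1.1.1.1 i).2.2)), ω.1.1.2.1)) :=
    H_congr _ _ _ (by
        intro ω ω'
        simp only [vS1, vK, vX1, vW, Prod.mk.injEq]
        tauto)
  have c4 : H (m4 q ch (encC C) (decC C)) (fun ω => (vK ω, vX1 ω, vW ω)) =
      H (m4 q ch (encC C) (decC C)) (fun ω => (ω.1.1.1.2, (fun i => (ω.1.1.1.1 i).1),
        (fun i => (ω.1.1.1.1 i).2.2))) := rfl
  rw [c1, c2, c3, c4]
  linarith

include hch in
lemma dist_chan (e : (Fin n → X1 × X2 × W) → KK k1 k2 → SS Xt1 Xt2 n → ℝ) (t : Fin n)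
    (r : O2 X1 X2 W Xt1 Xt2 n k1 k2) (g : Yt × Zt) :
    dist (m3 q ch e) (fun ω => (ω.1, ω.2 t)) (r, g) =
      dist (m3 q ch e) (fun ω => ω.1) r * ch (r.2.1 t, r.2.2 t) g := by
  unfold m3
  rw [dist_kp_self' _ _ (fun _ => pp_pmf fun _ => hch _) (fun g => g t)]
  congr 1
  exact congrFun (dist_pp (p := fun i => ch (r.2.1 i, r.2.2 i)) (fun _ => hch _) t) g

include hch in
lemma factD : ∑ t, (H (m4 q ch (encC C) (decC C)) (fun ω => (vV ω t, vZ ω t, vS1 ω t, vS2 ω t)) -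
      H (m4 q ch (encC C) (decC C)) (fun ω => (vS1 ω t, vS2 ω t))) ≤
    H (m4 q ch (encC C) (decC C))
      (fun ω => (vV ω, vZ ω, vS1 ω, vS2 ω, (vK ω, vX1 ω, vX2 ω, vW ω))) -
    H (m4 q ch (encC C) (decC C)) (fun ω => (vS1 ω, vS2 ω, (vK ω, vX1 ω, vX2 ω, vW ω))) := by
  have a : ∀ t, H (m4 q ch (encC C) (decC C)) (fun ω => (vV ω t, vZ ω t, vS1 ω t, vS2 ω t)) -
      H (m4 q ch (encC C) (decC C)) (fun ω => (vS1 ω t, vS2 ω t)) =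
      ∑ ω, m3 q ch (encC C) ω * hh (ch (ω.1.2.1 t, ω.1.2.2 t)) := by
    intro t
    rw [← H_kernel_comp (m3 q ch (encC C)) (fun ω => ω.1) (fun ω => ω.2 t)
      (fun r => (r.2.1 t, r.2.2 t)) ch hch (dist_chan hch (encC C) t), ← H_red3 C, ← H_red3 C]
    congr 1
    exact H_congr _ _ _ (by
      intro ω ω'
      simp only [vV, vZ, vS1, vS2, Prod.mk.injEq, Prod.ext_iff]
      tauto)
  have b := H_kernel (m3 q ch (encC C)) (fun ω => ω.1) (fun ω => ω.2)
    (fun r => pp (fun i => ch (r.2.1 i, r.2.2 i))) (fun _ => pp_pmf fun _ => hch _) (by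
      intro r g
      unfold m3
      rw [dist_kp_self' _ _ (fun _ => pp_pmf fun _ => hch _) (fun g => g), dist_id])
  rw [← H_red3 C, ← H_red3 C] at b
  have c1 : H (m4 q ch (encC C) (decC C))
      (fun ω => (vV ω, vZ ω, vS1 ω, vS2 ω, (vK ω, vX1 ω, vX2 ω, vW ω))) =
      H (m4 q ch (encC C) (decC C)) (fun ω => (ω.1.1, ω.1.2)) := H_congr _ _ _ (by
      intro ω ω'
      simp only [vV, vZ, vS1, vS2, vK, vX1, vX2, vW, Prod.mk.injEq, funext_iff, Prod.ext_iff,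
        forall_and]
      tauto)
  have c2 : H (m4 q ch (encC C) (decC C))
      (fun ω => (vS1 ω, vS2 ω, (vK ω, vX1 ω, vX2 ω, vW ω))) =
      H (m4 q ch (encC C) (decC C)) (fun ω => ω.1.1) := H_congr _ _ _ (by
      intro ω ω'
      simp only [vS1, vS2, vK, vX1, vX2, vW, Prod.mk.injEq, funext_iff, Prod.ext_iff,
        forall_and]
      tauto)
  rw [c1, c2, b]
  simp only [a, hh_pp (fun _ => hch _)]
  rw [Finset.sum_comm]
  simp only [Finset.mul_sum]
  linarith

end Facts

end Model

section TVPart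

set_option linter.unusedSectionVars false
set_option linter.unusedSimpArgs false

variable {n k1 k2 : ℕ}

lemma sum_ite_single {α : Type*} [Fintype α] (z : α) {_ : ∀ a, Decidable (a = z)} (f : α → ℝ) :
    ∑ a, (if a = z then f a else 0) = f z := by
  rw [Finset.sum_eq_single z]
  · simp
  · intro b _ hb; simp [hb]
  · simp

/-- Rearrangement of the block sample space. -/
def eqv : (Fin k1 × Fin k2 × (Fin n → Xt1) × (Fin n → Xt2) × (Fin n → Yt)) ×
    ((Fin n → X1) × (Fin n → X2) × (Fin n → W) × (Fin n → Y) × (Fin n → Zt)) ≃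
    O4 X1 X2 W Y Xt1 Xt2 Yt Zt n k1 k2 where
  toFun r := ((((fun i => (r.2.1 i, r.2.2.1 i, r.2.2.2.1 i), (r.1.1, r.1.2.1)),
    (r.1.2.2.1, r.1.2.2.2.1)), fun i => (r.1.2.2.2.2 i, r.2.2.2.2.2 i)), r.2.2.2.2.1)
  invFun ω := ((ω.1.1.1.2.1, ω.1.1.1.2.2, ω.1.1.2.1, ω.1.1.2.2, fun i => (ω.1.2 i).1),
    (fun i => (ω.1.1.1.1 i).1, fun i => (ω.1.1.1.1 i).2.1, fun i => (ω.1.1.1.1 i).2.2, ω.2,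
      fun i => (ω.1.2 i).2))
  left_inv _ := rfl
  right_inv _ := rfl

variable (q : X1 × X2 × W × Y → ℝ) (ch : Xt1 × Xt2 → Yt × Zt → ℝ)
    (C : Code X1 X2 W Y Xt1 Xt2 Yt n k1 k2)

lemma m4_pInd : dist (m4 q ch (encC C) (decC C)) (fun ω => (vX1 ω, vX2 ω, vW ω, vY ω, vZ ω)) =
    pInd q ch C := by
  classical
  funext v
  rw [dist_eq, ← Equiv.sum_comp eqv, Fintype.sum_prod_type]
  have h : ∀ r (u : (Fin n → X1) × (Fin n → X2) × (Fin n → W) × (Fin n → Y) × (Fin n → Zt)),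
      (vX1 ((eqv (r, u) : O4 X1 X2 W Y Xt1 Xt2 Yt Zt n k1 k2)), vX2 ((eqv (r, u) : O4 X1 X2 W Y Xt1 Xt2 Yt Zt n k1 k2)),
        vW ((eqv (r, u) : O4 X1 X2 W Y Xt1 Xt2 Yt Zt n k1 k2)), vY ((eqv (r, u) : O4 X1 X2 W Y Xt1 Xt2 Yt Zt n k1 k2)),
        vZ ((eqv (r, u) : O4 X1 X2 W Y Xt1 Xt2 Yt Zt n k1 k2))) = u := fun _ _ => rfl
  simp only [h]
  refine (Finset.sum_congr rfl fun r _ => sum_ite_single v _).trans ?_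
  simp only [Fintype.sum_prod_type]
  obtain ⟨x1, x2, w, y, z⟩ := v
  simp only [pInd, pFull]
  refine Finset.sum_congr rfl fun a _ => Finset.sum_congr rfl fun b _ =>
    Finset.sum_congr rfl fun s1 _ => Finset.sum_congr rfl fun s2 _ =>
    Finset.sum_congr rfl fun v _ => ?_
  simp only [eqv, Equiv.coe_fn_mk, m4, m3, m2, m1, kp, pp, srcP, unifK, encC, decC]
  ring

lemma m4_pIndZ : dist (m4 q ch (encC C) (decC C)) vZ = pIndZ q ch C := by
  classical
  funext z
  have h := dist_dist (m4 q ch (encC C) (decC C)) (fun ω => (vX1 ω, vX2 ω, vW ω, vY ω, vZ ω))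
    (fun v => v.2.2.2.2)
  rw [m4_pInd] at h
  have h2 := congrFun h z
  have e : (vZ : O4 X1 X2 W Y Xt1 Xt2 Yt Zt n k1 k2 → Fin n → Zt) = fun ω => vZ ω := rfl
  rw [e, ← h2, dist_eq]
  simp only [Fintype.sum_prod_type, pIndZ]
  refine Finset.sum_congr rfl fun a _ => Finset.sum_congr rfl fun b _ =>
    Finset.sum_congr rfl fun s1 _ => Finset.sum_congr rfl fun s2 _ => ?_
  exact sum_ite_single z _

/-- Per-letter block of coordinated variables. -/
def vB : O4 X1 X2 W Y Xt1 Xt2 Yt Zt n k1 k2 → Fin n → X1 × X2 × W × Y :=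
  fun ω i => (vX1 ω i, vX2 ω i, vW ω i, vY ω i)

/-- Zipping equivalence. -/
def eqB : ((Fin n → X1) × (Fin n → X2) × (Fin n → W) × (Fin n → Y) × (Fin n → Zt)) ≃
    (Fin n → X1 × X2 × W × Y) × (Fin n → Zt) where
  toFun v := (fun i => (v.1 i, v.2.1 i, v.2.2.1 i, v.2.2.2.1 i), v.2.2.2.2)
  invFun u := (fun i => (u.1 i).1, fun i => (u.1 i).2.1, fun i => (u.1 i).2.2.1,
    fun i => (u.1 i).2.2.2, u.2)
  left_inv _ := rfl
  right_inv _ := rfl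

/-- TV to target. -/
noncomputable def tv : ℝ := TV (pInd q ch C)
          (fun v => pIndZ q ch C v.2.2.2.2 *
            ∏ i, q (v.1 i, v.2.1 i, v.2.2.1 i, v.2.2.2.1 i))

lemma tv_BZ : TV (dist (m4 q ch (encC C) (decC C)) (fun ω => (vB ω, vZ ω)))
    (kp (pp (fun _ : Fin n => q)) (fun _ => pIndZ q ch C)) ≤ tv q ch C := by
  have h := TV_dist (pInd q ch C) (fun v => pIndZ q ch C v.2.2.2.2 *
            ∏ i, q (v.1 i, v.2.1 i, v.2.2.1 i, v.2.2.2.1 i)) (fun v => eqB v)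
  refine le_trans (le_of_eq ?_) h
  congr 1
  · rw [← m4_pInd, dist_dist]
    rfl
  · funext u
    rw [dist_equiv]
    simp only [kp, pp, eqB, Equiv.coe_fn_symm_mk]
    ring

variable {q ch}

lemma tv_B (hq : IsPMF q) (hch : ∀ x, IsPMF (ch x)) (h1 : 1 ≤ k1) (h2 : 1 ≤ k2) :
    TV (dist (m4 q ch (encC C) (decC C)) vB) (pp (fun _ : Fin n => q)) ≤ tv q ch C := by
  refine le_trans ?_ (tv_BZ q ch C)
  have h := TV_dist (dist (m4 q ch (encC C) (decC C)) (fun ω => (vB ω, vZ ω)))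
    (kp (pp (fun _ : Fin n => q)) (fun _ => pIndZ q ch C)) (fun v => v.1)
  rw [dist_dist, dist_kp_fst (κ := fun _ => pIndZ q ch C) (X := fun v => v), dist_id] at h
  · exact h
  · intro _
    rw [← m4_pIndZ]
    exact dist_pmf (m4_pmf hq h1 h2 hch (encC_pmf C) (decC_pmf C)) _

lemma tv_Bt (hq : IsPMF q) (hch : ∀ x, IsPMF (ch x)) (h1 : 1 ≤ k1) (h2 : 1 ≤ k2) (t : Fin n) :
    TV (dist (m4 q ch (encC C) (decC C)) (fun ω => vB ω t)) q ≤ tv q ch C := by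
  refine le_trans ?_ (tv_B C hq hch h1 h2)
  have h := TV_dist (dist (m4 q ch (encC C) (decC C)) vB) (pp (fun _ : Fin n => q)) (fun v => v t)
  rw [dist_dist, dist_pp (fun _ => hq)] at h
  exact h

lemma factE (hq : IsPMF q) (hch : ∀ x, IsPMF (ch x)) (h1 : 1 ≤ k1) (h2 : 1 ≤ k2) (hn : 0 < n)
    (hZ : 0 < Fintype.card Zt) (d0 : ℝ) (hT : tv q ch C ≤ 1)
    (hd : ∀ τ, 0 ≤ τ → τ ≤ tv q ch C →
      modu ((Fintype.card X1 * Fintype.card X2 * Fintype.card W * Fintype.card Y *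
        Fintype.card Zt : ℕ) : ℝ) τ ≤ d0) :
    (∑ t, H (m4 q ch (encC C) (decC C)) (fun ω => (vX1 ω t, vX2 ω t, vW ω t, vY ω t)) ≤
      H (m4 q ch (encC C) (decC C)) (fun ω => (vX1 ω, vX2 ω, vW ω, vY ω)) + 2 * n * d0) ∧
    (H (m4 q ch (encC C) (decC C)) (fun ω => (vX1 ω, vX2 ω, vW ω, vY ω)) +
      H (m4 q ch (encC C) (decC C)) vZ ≤
      H (m4 q ch (encC C) (decC C)) (fun ω => (vZ ω, vX1 ω, vX2 ω, vW ω, vY ω)) + 2 * n * d0) := by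
  classical
  have hM : IsPMF (m4 q ch (encC C) (decC C)) :=
    m4_pmf hq h1 h2 hch (encC_pmf C) (decC_pmf C)
  set M := m4 q ch (encC C) (decC C) with hMdef
  set N := Fintype.card X1 * Fintype.card X2 * Fintype.card W * Fintype.card Y *
        Fintype.card Zt with hN
  have hNN : Fintype.card (X1 × X2 × W × Y) * Fintype.card Zt = N := by
    simp only [Fintype.card_prod, hN]; ring
  have hN1 : Fintype.card (X1 × X2 × W × Y) ≤ N := by
    rw [← hNN]; exact Nat.le_mul_of_pos_right _ hZ
  have hNn : Fintype.card (Fin n → X1 × X2 × W × Y) ≤ N ^ n := by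
    rw [Fintype.card_fun, Fintype.card_fin]; exact Nat.pow_le_pow_left hN1 n
  have hNz : Fintype.card ((Fin n → X1 × X2 × W × Y) × (Fin n → Zt)) ≤ N ^ n := by
    rw [Fintype.card_prod, Fintype.card_fun, Fintype.card_fun, Fintype.card_fin, ← mul_pow, hNN]
  have hpZ : IsPMF (pIndZ q ch C) := by
    rw [← m4_pIndZ]; exact dist_pmf hM _
  have hn' : (0:ℝ) < n := by exact_mod_cast hn
  have eB : H M (fun ω => (vX1 ω, vX2 ω, vW ω, vY ω)) = hh (dist M vB) := by
    rw [← H_eq_hh]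
    exact H_congr _ _ _ (by
      intro ω ω'
      simp only [vB, Prod.mk.injEq, funext_iff, forall_and])
  have eBZ : H M (fun ω => (vZ ω, vX1 ω, vX2 ω, vW ω, vY ω)) =
      hh (dist M (fun ω => (vB ω, vZ ω))) := by
    rw [← H_eq_hh]
    exact H_congr _ _ _ (by
      intro ω ω'
      simp only [vB, Prod.mk.injEq, funext_iff, forall_and]
      tauto)
  have eZ : H M vZ = hh (pIndZ q ch C) := by
    rw [H_eq_hh, m4_pIndZ]
  have eq : hh (pp (fun _ : Fin n => q)) = n * hh q := by
    rw [hh_pp (fun _ => hq)]; simp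
  have hpp : IsPMF (pp (fun _ : Fin n => q)) := pp_pmf fun _ => hq
  have hkp : IsPMF (kp (pp (fun _ : Fin n => q)) (fun _ => pIndZ q ch C)) :=
    kp_pmf hpp (fun _ => hpZ)
  have c1 := hh_cont _ _ hpp (dist_pmf hM vB) n hn N hNn (by
    rw [TV_comm]; exact (tv_B C hq hch h1 h2).trans hT)
  have c2 := hh_cont _ _ (dist_pmf hM vB) hpp n hn N hNn ((tv_B C hq hch h1 h2).trans hT)
  have c3 := hh_cont _ _ hkp (dist_pmf hM (fun ω => (vB ω, vZ ω))) n hn N hNz (by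
    rw [TV_comm]; exact (tv_BZ q ch C).trans hT)
  rw [hh_kp_const _ hpp _ hpZ] at c3
  have b1 := hd _ (TV_nonneg (dist M vB) _) (tv_B C hq hch h1 h2)
  have b3 := hd _ (TV_nonneg (dist M (fun ω => (vB ω, vZ ω))) _) (tv_BZ q ch C)
  rw [TV_comm] at c1 c3
  have b1' := mul_le_mul_of_nonneg_left b1 hn'.le
  have b3' := mul_le_mul_of_nonneg_left b3 hn'.le
  constructor
  · have ct : ∀ t, H M (fun ω => (vX1 ω t, vX2 ω t, vW ω t, vY ω t)) ≤ hh q + d0 := by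
      intro t
      have c4 := hh_cont _ _ (dist_pmf hM (fun ω => vB ω t)) hq 1 one_pos N (by simpa using hN1)
        ((tv_Bt C hq hch h1 h2 t).trans hT)
      have b4 := hd _ (TV_nonneg (dist M (fun ω => vB ω t)) _) (tv_Bt C hq hch h1 h2 t)
      rw [← H_eq_hh] at c4
      have e : (fun ω : O4 X1 X2 W Y Xt1 Xt2 Yt Zt n k1 k2 =>
        (vX1 ω t, vX2 ω t, vW ω t, vY ω t)) = fun ω => vB ω t := rfl
      rw [e]
      push_cast at c4
      linarith
    have := Finset.sum_le_sum fun t (_ : t ∈ Finset.univ) => ct t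
    rw [Finset.sum_const, Finset.card_univ, Fintype.card_fin, nsmul_eq_mul] at this
    rw [eB]
    linarith
  · rw [eB, eBZ, eZ]
    linarith

end TVPart

section PerLetter

set_option linter.unusedSectionVars false
set_option linter.unusedSimpArgs false

lemma upd_iff {α : Type*} {n : ℕ} (f g : Fin n → α) (t : Fin n) (c : α) :
    (Function.update f t c = Function.update g t c ∧ f t = g t) ↔ f = g := by
  constructor
  · rintro ⟨h1, h2⟩
    funext i
    by_cases hi : i = t
    · rw [hi, h2]
    · have := congrFun h1 i
      simpa [Function.update_of_ne hi] using this
  · rintro rfl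
    simp

section Gen

variable {Ω : Type*} [Fintype Ω] {A B V : Type} [Fintype A] [Fintype B] [Fintype V] {n : ℕ}
  {μ : Ω → ℝ} (hμ : IsPMF μ) (x1 : Ω → Fin n → X1) (x2 : Ω → Fin n → X2) (w : Ω → Fin n → W)
  (y : Ω → Fin n → Y) (v : Ω → Fin n → V) (ka : Ω → A) (kb : Ω → B) (w0 : W) (t : Fin n)

include hμ in
lemma L_a : CMI μ (fun ω => (ka ω, v ω, Function.update (w ω) t w0)) (fun ω => x1 ω t)
      (fun ω => (kb ω, x2 ω t, w ω t)) ≤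
    (H μ (fun ω => (x1 ω t, x2 ω t, w ω t)) - H μ (fun ω => (x2 ω t, w ω t))) +
      (H μ (fun ω => ((ka ω, kb ω), v ω, w ω, x2 ω t)) -
        H μ (fun ω => (x1 ω t, (ka ω, kb ω), v ω, w ω, x2 ω t))) := by
  unfold CMI
  rw [H_congr μ (fun ω => ((ka ω, v ω, Function.update (w ω) t w0), kb ω, x2 ω t, w ω t))
      (fun ω => ((ka ω, kb ω), v ω, w ω, x2 ω t)) (by
        intro ω ω'
        have := upd_iff (w ω) (w ω') t w0
        simp only [Prod.mk.injEq]
        tauto),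
    H_congr μ (fun ω => ((ka ω, v ω, Function.update (w ω) t w0), x1 ω t, kb ω, x2 ω t, w ω t))
      (fun ω => (x1 ω t, (ka ω, kb ω), v ω, w ω, x2 ω t)) (by
        intro ω ω'
        have := upd_iff (w ω) (w ω') t w0
        simp only [Prod.mk.injEq]
        tauto)]
  have := H_submod hμ (fun ω => (x1 ω t, kb ω, x2 ω t, w ω t)) (fun ω => (x2 ω t, w ω t))
    (fun ω => (x1 ω t, x2 ω t, w ω t)) (fun ω => (kb ω, x2 ω t, w ω t))
    (by intro ω ω'; simp only [Prod.mk.injEq]; tauto)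
    (by intro ω ω'; simp only [Prod.mk.injEq]; tauto)
    (by intro ω ω'; simp only [Prod.mk.injEq]; tauto)
  linarith

include hμ in
lemma L_b : CMI μ kb (fun ω => x2 ω t)
      (fun ω => ((ka ω, v ω, Function.update (w ω) t w0), x1 ω t, w ω t)) ≤
    (H μ (fun ω => (x2 ω t, x1 ω t, w ω t)) - H μ (fun ω => (x1 ω t, w ω t))) +
      (H μ (fun ω => ((ka ω, kb ω), v ω, w ω, x1 ω t)) -
        H μ (fun ω => (x2 ω t, (ka ω, kb ω), v ω, w ω, x1 ω t))) := by
  unfold CMI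
  rw [H_congr μ (fun ω => (kb ω, (ka ω, v ω, Function.update (w ω) t w0), x1 ω t, w ω t))
      (fun ω => ((ka ω, kb ω), v ω, w ω, x1 ω t)) (by
        intro ω ω'
        have := upd_iff (w ω) (w ω') t w0
        simp only [Prod.mk.injEq]
        tauto),
    H_congr μ (fun ω => (kb ω, x2 ω t, (ka ω, v ω, Function.update (w ω) t w0), x1 ω t, w ω t))
      (fun ω => (x2 ω t, (ka ω, kb ω), v ω, w ω, x1 ω t)) (by
        intro ω ω'
        have := upd_iff (w ω) (w ω') t w0
        simp only [Prod.mk.injEq]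
        tauto)]
  have := H_submod hμ
    (fun ω => (x2 ω t, (ka ω, v ω, Function.update (w ω) t w0), x1 ω t, w ω t))
    (fun ω => (x1 ω t, w ω t))
    (fun ω => (x2 ω t, x1 ω t, w ω t))
    (fun ω => ((ka ω, v ω, Function.update (w ω) t w0), x1 ω t, w ω t))
    (by intro ω ω'; simp only [Prod.mk.injEq]; tauto)
    (by intro ω ω'; simp only [Prod.mk.injEq]; tauto)
    (by intro ω ω'; simp only [Prod.mk.injEq]; tauto)
  linarith

lemma L_c : CMI μ (fun ω => ((ka ω, v ω, Function.update (w ω) t w0), kb ω))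
      (fun ω => (x1 ω t, x2 ω t)) (fun ω => w ω t) =
    (H μ (fun ω => (x1 ω t, x2 ω t, w ω t)) - H μ (fun ω => w ω t)) +
      (H μ (fun ω => ((ka ω, kb ω), v ω, w ω)) -
        H μ (fun ω => ((x1 ω t, x2 ω t), (ka ω, kb ω), v ω, w ω))) := by
  unfold CMI
  rw [H_congr μ (fun ω => (((ka ω, v ω, Function.update (w ω) t w0), kb ω), w ω t))
      (fun ω => ((ka ω, kb ω), v ω, w ω)) (by
        intro ω ω'
        have := upd_iff (w ω) (w ω') t w0
        simp only [Prod.mk.injEq]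
        tauto),
    H_congr μ (fun ω => (((ka ω, v ω, Function.update (w ω) t w0), kb ω), (x1 ω t, x2 ω t), w ω t))
      (fun ω => ((x1 ω t, x2 ω t), (ka ω, kb ω), v ω, w ω)) (by
        intro ω ω'
        have := upd_iff (w ω) (w ω') t w0
        simp only [Prod.mk.injEq]
        tauto),
    H_congr μ (fun ω => ((x1 ω t, x2 ω t), w ω t)) (fun ω => (x1 ω t, x2 ω t, w ω t)) (by
        intro ω ω'
        simp only [Prod.mk.injEq]
        tauto)]
  ring

lemma L_d : CMI μ (fun ω => ((ka ω, v ω, Function.update (w ω) t w0), kb ω))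
      (fun ω => (x1 ω t, x2 ω t, y ω t)) (fun ω => w ω t) =
    (H μ (fun ω => (x1 ω t, x2 ω t, w ω t, y ω t)) - H μ (fun ω => w ω t)) +
      (H μ (fun ω => ((ka ω, kb ω), v ω, w ω)) -
        H μ (fun ω => ((x1 ω t, x2 ω t, y ω t), (ka ω, kb ω), v ω, w ω))) := by
  unfold CMI
  rw [H_congr μ (fun ω => (((ka ω, v ω, Function.update (w ω) t w0), kb ω), w ω t))
      (fun ω => ((ka ω, kb ω), v ω, w ω)) (by
        intro ω ω'
        have := upd_iff (w ω) (w ω') t w0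
        simp only [Prod.mk.injEq]
        tauto),
    H_congr μ (fun ω => (((ka ω, v ω, Function.update (w ω) t w0), kb ω),
        (x1 ω t, x2 ω t, y ω t), w ω t))
      (fun ω => ((x1 ω t, x2 ω t, y ω t), (ka ω, kb ω), v ω, w ω)) (by
        intro ω ω'
        have := upd_iff (w ω) (w ω') t w0
        simp only [Prod.mk.injEq]
        tauto),
    H_congr μ (fun ω => ((x1 ω t, x2 ω t, y ω t), w ω t))
      (fun ω => (x1 ω t, x2 ω t, w ω t, y ω t)) (by
        intro ω ω'
        simp only [Prod.mk.injEq]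
        tauto)]
  ring

lemma L_e : CMI μ (fun ω => (ka ω, v ω, Function.update (w ω) t w0))
      (fun ω => (x1 ω t, x2 ω t, y ω t)) (fun ω => w ω t) =
    (H μ (fun ω => (x1 ω t, x2 ω t, w ω t, y ω t)) - H μ (fun ω => w ω t)) +
      (H μ (fun ω => (ka ω, v ω, w ω)) -
        H μ (fun ω => ((x1 ω t, x2 ω t, y ω t), ka ω, v ω, w ω))) := by
  unfold CMI
  rw [H_congr μ (fun ω => ((ka ω, v ω, Function.update (w ω) t w0), w ω t))
      (fun ω => (ka ω, v ω, w ω)) (by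
        intro ω ω'
        have := upd_iff (w ω) (w ω') t w0
        simp only [Prod.mk.injEq]
        tauto),
    H_congr μ (fun ω => ((ka ω, v ω, Function.update (w ω) t w0),
        (x1 ω t, x2 ω t, y ω t), w ω t))
      (fun ω => ((x1 ω t, x2 ω t, y ω t), ka ω, v ω, w ω)) (by
        intro ω ω'
        have := upd_iff (w ω) (w ω') t w0
        simp only [Prod.mk.injEq]
        tauto),
    H_congr μ (fun ω => ((x1 ω t, x2 ω t, y ω t), w ω t))
      (fun ω => (x1 ω t, x2 ω t, w ω t, y ω t)) (by
        intro ω ω'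
        simp only [Prod.mk.injEq]
        tauto)]
  ring

include hμ in
lemma L_f : CMI μ kb (fun ω => (x1 ω t, x2 ω t, y ω t)) (fun ω => w ω t) ≤
    (H μ (fun ω => (x1 ω t, x2 ω t, w ω t, y ω t)) - H μ (fun ω => w ω t)) +
      (H μ (fun ω => (kb ω, v ω, w ω)) -
        H μ (fun ω => ((x1 ω t, x2 ω t, y ω t), kb ω, v ω, w ω))) := by
  unfold CMI
  rw [H_congr μ (fun ω => ((x1 ω t, x2 ω t, y ω t), w ω t))
      (fun ω => (x1 ω t, x2 ω t, w ω t, y ω t)) (by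
        intro ω ω'
        simp only [Prod.mk.injEq]
        tauto)]
  have := H_submod hμ
    (fun ω => ((x1 ω t, x2 ω t, y ω t), kb ω, v ω, w ω))
    (fun ω => (kb ω, w ω t))
    (fun ω => (kb ω, v ω, w ω))
    (fun ω => (kb ω, (x1 ω t, x2 ω t, y ω t), w ω t))
    (by
      intro ω ω'
      have := fun h : w ω = w ω' => congrFun h t
      simp only [Prod.mk.injEq]
      tauto)
    (by
      intro ω ω'
      have := fun h : w ω = w ω' => congrFun h t
      simp only [Prod.mk.injEq]; tauto)
    (by intro ω ω'; simp only [Prod.mk.injEq]; tauto)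
  linarith

end Gen

variable {n k1 k2 : ℕ} {q : X1 × X2 × W × Y → ℝ} (hq : IsPMF q) (h1 : 1 ≤ k1) (h2 : 1 ≤ k2)
    {ch : Xt1 × Xt2 → Yt × Zt → ℝ} (hch : ∀ x, IsPMF (ch x))
    (C : Code X1 X2 W Y Xt1 Xt2 Yt n k1 k2) (w0 : W)

/-- The auxiliary variable `U1` at time `t`. -/
def vU (w0 : W) (t : Fin n) : O4 X1 X2 W Y Xt1 Xt2 Yt Zt n k1 k2 →
    Fin k1 × (Fin n → Yt) × (Fin n → W) :=
  fun ω => ((vK ω).1, vV ω, Function.update (vW ω) t w0)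

include hq h1 h2 hch in
lemma ineq_a : ∑ t, CMI (m4 q ch (encC C) (decC C)) (vU w0 t) (fun ω => vX1 ω t)
      (fun ω => ((vK ω).2, vX2 ω t, vW ω t)) ≤
    ∑ t, CMI (m4 q ch (encC C) (decC C)) (fun ω => vS1 ω t) (fun ω => vV ω t)
      (fun ω => vS2 ω t) := by
  have hM := m4_pmf hq h1 h2 hch (encC_pmf C) (decC_pmf C)
  refine le_trans (Finset.sum_le_sum fun t _ => ?_)
    (core1 hM vX1 vX2 vW vS1 vS2 vV vK (factA hq h1 h2 hch C) (factB hq h1 h2 hch C)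
      (factC1 hch C) (chan_V hM vS1 vS2 vV vZ _ (factD hch C)))
  exact L_a hM vX1 vX2 vW vV (fun ω => (vK ω).1) (fun ω => (vK ω).2) w0 t

include hq h1 h2 hch in
lemma ineq_b : ∑ t, CMI (m4 q ch (encC C) (decC C)) (fun ω => (vK ω).2) (fun ω => vX2 ω t)
      (fun ω => (vU w0 t ω, vX1 ω t, vW ω t)) ≤
    ∑ t, CMI (m4 q ch (encC C) (decC C)) (fun ω => vS2 ω t) (fun ω => vV ω t)
      (fun ω => vS1 ω t) := by
  have hM := m4_pmf hq h1 h2 hch (encC_pmf C) (decC_pmf C)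
  have hA := factA hq h1 h2 hch C
  have hB := factB hq h1 h2 hch C
  have hD := chan_V hM vS1 vS2 vV vZ _ (factD (q := q) hch C)
  have e1 : H (m4 q ch (encC C) (decC C)) (fun ω => (vX1 ω, vX2 ω, vW ω)) =
      H (m4 q ch (encC C) (decC C)) (fun ω => (vX2 ω, vX1 ω, vW ω)) :=
    H_congr _ _ _ (by intro ω ω'; simp only [Prod.mk.injEq]; tauto)
  have e2 : H (m4 q ch (encC C) (decC C)) (fun ω => (vK ω, vX1 ω, vX2 ω, vW ω)) =
      H (m4 q ch (encC C) (decC C)) (fun ω => (vK ω, vX2 ω, vX1 ω, vW ω)) :=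
    H_congr _ _ _ (by intro ω ω'; simp only [Prod.mk.injEq]; tauto)
  have e3 : ∀ t, H (m4 q ch (encC C) (decC C)) (fun ω => (vX1 ω t, vX2 ω t, vW ω t)) =
      H (m4 q ch (encC C) (decC C)) (fun ω => (vX2 ω t, vX1 ω t, vW ω t)) := fun t =>
    H_congr _ _ _ (by intro ω ω'; simp only [Prod.mk.injEq]; tauto)
  have e4 : ∀ t, H (m4 q ch (encC C) (decC C)) (fun ω => (vV ω t, vS1 ω t, vS2 ω t)) =
      H (m4 q ch (encC C) (decC C)) (fun ω => (vV ω t, vS2 ω t, vS1 ω t)) := fun t =>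
    H_congr _ _ _ (by intro ω ω'; simp only [Prod.mk.injEq]; tauto)
  have e5 : ∀ t, H (m4 q ch (encC C) (decC C)) (fun ω => (vS1 ω t, vS2 ω t)) =
      H (m4 q ch (encC C) (decC C)) (fun ω => (vS2 ω t, vS1 ω t)) := fun t =>
    H_congr _ _ _ (by intro ω ω'; simp only [Prod.mk.injEq]; tauto)
  have e6 : H (m4 q ch (encC C) (decC C))
      (fun ω => (vV ω, vS1 ω, vS2 ω, (vK ω, vX1 ω, vX2 ω, vW ω))) =
      H (m4 q ch (encC C) (decC C))
      (fun ω => (vV ω, vS2 ω, vS1 ω, (vK ω, vX2 ω, vX1 ω, vW ω))) :=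
    H_congr _ _ _ (by intro ω ω'; simp only [Prod.mk.injEq]; tauto)
  have e7 : H (m4 q ch (encC C) (decC C))
      (fun ω => (vS1 ω, vS2 ω, (vK ω, vX1 ω, vX2 ω, vW ω))) =
      H (m4 q ch (encC C) (decC C))
      (fun ω => (vS2 ω, vS1 ω, (vK ω, vX2 ω, vX1 ω, vW ω))) :=
    H_congr _ _ _ (by intro ω ω'; simp only [Prod.mk.injEq]; tauto)
  rw [e1, e2] at hA
  rw [e1] at hB
  simp only [e3] at hB
  simp only [e4, e5, e6, e7] at hD
  refine le_trans (Finset.sum_le_sum fun t _ => ?_)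
    (core1 hM vX2 vX1 vW vS2 vS1 vV vK hA hB (factC2 hch C) hD)
  exact L_b hM vX1 vX2 vW vV (fun ω => (vK ω).1) (fun ω => (vK ω).2) w0 t

include hq h1 h2 hch in
lemma ineq_c : ∑ t, CMI (m4 q ch (encC C) (decC C)) (fun ω => (vU w0 t ω, (vK ω).2))
      (fun ω => (vX1 ω t, vX2 ω t)) (fun ω => vW ω t) ≤
    ∑ t, CMI (m4 q ch (encC C) (decC C)) (fun ω => (vS1 ω t, vS2 ω t)) (fun ω => vV ω t)
      (fun _ => ()) := by
  have hM := m4_pmf hq h1 h2 hch (encC_pmf C) (decC_pmf C)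
  refine le_trans (Finset.sum_le_sum fun t _ => ?_)
    (core3 hM vX1 vX2 vW vS1 vS2 vV vK (factA hq h1 h2 hch C) (factB hq h1 h2 hch C)
      (chan_V hM vS1 vS2 vV vZ _ (factD hch C)))
  exact le_of_eq (L_c vX1 vX2 vW vV (fun ω => (vK ω).1) (fun ω => (vK ω).2) w0 t)

section
variable {d : ℝ}
  (hE : (∑ t, H (m4 q ch (encC C) (decC C)) (fun ω => (vX1 ω t, vX2 ω t, vW ω t, vY ω t)) ≤
      H (m4 q ch (encC C) (decC C)) (fun ω => (vX1 ω, vX2 ω, vW ω, vY ω)) + d) ∧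
    (H (m4 q ch (encC C) (decC C)) (fun ω => (vX1 ω, vX2 ω, vW ω, vY ω)) +
      H (m4 q ch (encC C) (decC C)) vZ ≤
      H (m4 q ch (encC C) (decC C)) (fun ω => (vZ ω, vX1 ω, vX2 ω, vW ω, vY ω)) + d))

include hq h1 h2 hch hE in
lemma core2' {L : Type} [Fintype L] (l : O4 X1 X2 W Y Xt1 Xt2 Yt Zt n k1 k2 → L) :
    ∑ t, ((H (m4 q ch (encC C) (decC C)) (fun ω => (vX1 ω t, vX2 ω t, vW ω t, vY ω t)) -
        H (m4 q ch (encC C) (decC C)) (fun ω => vW ω t)) +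
      (H (m4 q ch (encC C) (decC C)) (fun ω => (l ω, vV ω, vW ω)) -
        H (m4 q ch (encC C) (decC C))
          (fun ω => ((vX1 ω t, vX2 ω t, vY ω t), l ω, vV ω, vW ω)))) ≤
    Real.logb 2 (Fintype.card L) +
    ∑ t, condEnt (m4 q ch (encC C) (decC C)) (fun ω => vY ω t)
      (fun ω => (vX1 ω t, vX2 ω t, vW ω t)) +
    ∑ t, CMI (m4 q ch (encC C) (decC C)) (fun ω => (vS1 ω t, vS2 ω t)) (fun ω => vV ω t)
      (fun ω => vZ ω t) + 2 * d := by
  have hM := m4_pmf hq h1 h2 hch (encC_pmf C) (decC_pmf C)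
  exact core2 hM vX1 vX2 vW vY vS1 vS2 vV vZ vK l d _ (H_le_card hM l) hE.1 hE.2
    (chan_VZ hM vS1 vS2 vV vZ _ (factD hch C))

include hq h1 h2 hch hE in
lemma ineq_d : ∑ t, CMI (m4 q ch (encC C) (decC C)) (fun ω => (vU w0 t ω, (vK ω).2))
      (fun ω => (vX1 ω t, vX2 ω t, vY ω t)) (fun ω => vW ω t) ≤
    Real.logb 2 k1 + Real.logb 2 k2 +
    ∑ t, condEnt (m4 q ch (encC C) (decC C)) (fun ω => vY ω t)
      (fun ω => (vX1 ω t, vX2 ω t, vW ω t)) +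
    ∑ t, CMI (m4 q ch (encC C) (decC C)) (fun ω => (vS1 ω t, vS2 ω t)) (fun ω => vV ω t)
      (fun ω => vZ ω t) + 2 * d := by
  have h := core2' hq h1 h2 hch C hE vK
  have e : Real.logb 2 (Fintype.card (KK k1 k2)) = Real.logb 2 k1 + Real.logb 2 k2 := by
    rw [Fintype.card_prod, Fintype.card_fin, Fintype.card_fin, Nat.cast_mul, Real.logb_mul]
    · positivity
    · positivity
  rw [e] at h
  refine le_trans (Finset.sum_le_sum fun t _ => ?_) h
  exact le_of_eq (L_d vX1 vX2 vW vY vV (fun ω => (vK ω).1) (fun ω => (vK ω).2) w0 t)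

include hq h1 h2 hch hE in
lemma ineq_e : ∑ t, CMI (m4 q ch (encC C) (decC C)) (vU w0 t)
      (fun ω => (vX1 ω t, vX2 ω t, vY ω t)) (fun ω => vW ω t) ≤
    Real.logb 2 k1 +
    ∑ t, condEnt (m4 q ch (encC C) (decC C)) (fun ω => vY ω t)
      (fun ω => (vX1 ω t, vX2 ω t, vW ω t)) +
    ∑ t, CMI (m4 q ch (encC C) (decC C)) (fun ω => (vS1 ω t, vS2 ω t)) (fun ω => vV ω t)
      (fun ω => vZ ω t) + 2 * d := by
  have h := core2' hq h1 h2 hch C hE (fun ω => (vK ω).1)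
  rw [Fintype.card_fin] at h
  refine le_trans (Finset.sum_le_sum fun t _ => ?_) h
  exact le_of_eq (L_e vX1 vX2 vW vY vV (fun ω => (vK ω).1) w0 t)

include hq h1 h2 hch hE in
lemma ineq_f : ∑ t, CMI (m4 q ch (encC C) (decC C)) (fun ω => (vK ω).2)
      (fun ω => (vX1 ω t, vX2 ω t, vY ω t)) (fun ω => vW ω t) ≤
    Real.logb 2 k2 +
    ∑ t, condEnt (m4 q ch (encC C) (decC C)) (fun ω => vY ω t)
      (fun ω => (vX1 ω t, vX2 ω t, vW ω t)) +
    ∑ t, CMI (m4 q ch (encC C) (decC C)) (fun ω => (vS1 ω t, vS2 ω t)) (fun ω => vV ω t)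
      (fun ω => vZ ω t) + 2 * d := by
  have h := core2' hq h1 h2 hch C hE (fun ω => (vK ω).2)
  rw [Fintype.card_fin] at h
  refine le_trans (Finset.sum_le_sum fun t _ => ?_) h
  exact L_f (m4_pmf hq h1 h2 hch (encC_pmf C) (decC_pmf C)) vX1 vX2 vW vY vV
    (fun ω => (vK ω).2) t

end

end PerLetter

section SingleLetter

set_option linter.unusedSectionVars false
set_option linter.unusedSimpArgs false

lemma dist_of_equiv {Ω α ρ : Type*} [Fintype Ω] [Fintype α] [Fintype ρ] (μ : Ω → ℝ) (X : Ω → α)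
    (e : ρ × α ≃ Ω) (h : ∀ r u, X (e (r, u)) = u) (a : α) :
    dist μ X a = ∑ r, μ (e (r, a)) := by
  classical
  rw [dist_eq, ← Equiv.sum_comp e, Fintype.sum_prod_type]
  simp only [h]
  exact Finset.sum_congr rfl fun r _ => sum_ite_single a _

variable {n k1 k2 : ℕ} (q : X1 × X2 × W × Y → ℝ)
    (ch : Xt1 × Xt2 → Yt × Zt → ℝ)
    (C : Code X1 X2 W Y Xt1 Xt2 Yt n k1 k2) (w0 : W)

/-- The pair `(U1, U2)` on the prefix sample space. -/
def vUU (w0 : W) (t : Fin n) : O3 X1 X2 W Xt1 Xt2 Yt Zt n k1 k2 →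
    (Fin k1 × (Fin n → Yt) × (Fin n → W)) × Fin k2 :=
  fun ω => ((ω.1.1.2.1, (fun i => (ω.2 i).1), Function.update (fun i => (ω.1.1.1 i).2.2) t w0),
    ω.1.1.2.2)

/-- Conditional law of the auxiliary variables. -/
noncomputable def cU (x1 : X1) (x2 : X2) (t : Fin n) :
    (Fin k1 × (Fin n → Yt) × (Fin n → W)) × Fin k2 → ℝ :=
  dist (m3 q ch (encU C t x1 x2)) (vUU w0 t)

/-- Conditional law of the output. -/
noncomputable def cY (u : Fin k1 × (Fin n → Yt) × (Fin n → W)) (b : Fin k2) (w : W) (t : Fin n) :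
    Y → ℝ :=
  dist (decC C (u.1, b) (Function.update u.2.2 t w) u.2.1) (fun y => y t)

/-- Law of the channel inputs at time `t`. -/
noncomputable def cX (t : Fin n) : Xt1 × Xt2 → ℝ :=
  dist (m4 q ch (encC C) (decC C)) (fun ω => (vS1 ω t, vS2 ω t))

variable {q ch}

lemma encU_eq (t : Fin n) (d : X1 × X2 × W) (x : Fin n → X1 × X2 × W) (k s) :
    encU C t d.1 d.2.1 x k s = encC C (Function.update x t d) k s := by
  unfold encU encC
  have e1 : Function.update (fun i => (x i).1) t d.1 = fun i => (Function.update x t d i).1 := by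
    funext i
    by_cases h : i = t
    · subst h; simp
    · simp [h]
  have e2 : Function.update (fun i => (x i).2.1) t d.2.1 =
      fun i => (Function.update x t d i).2.1 := by
    funext i
    by_cases h : i = t
    · subst h; simp
    · simp [h]
  rw [e1, e2]

lemma upd_upd (t : Fin n) (d : X1 × X2 × W) (x : Fin n → X1 × X2 × W) :
    Function.update (fun i => (Function.update x t d i).2.2) t w0 =
      Function.update (fun i => (x i).2.2) t w0 := by
  funext i
  by_cases h : i = t
  · subst h; simp
  · simp [h]

lemma src_match3 (hq : IsPMF q) (t : Fin n) (d : X1 × X2 × W)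
    (u : (Fin k1 × (Fin n → Yt) × (Fin n → W)) × Fin k2) :
    dist (m3 q ch (encC C)) (fun ω => (ω.1.1.1 t, vUU w0 t ω)) (d, u) =
      srcP q d * cU q ch C w0 d.1 d.2.1 t u := by
  classical
  have h := resample (fun _ : Fin n => srcP q) t (srcP_pmf hq).2 d
    (fun x => ∑ k : KK k1 k2, ∑ s : SS Xt1 Xt2 n, ∑ g : Fin n → Yt × Zt,
      if vUU w0 t (((x, k), s), g) = u then
        unifK k1 k2 k * encC C x k s * pp (fun i => ch (s.1 i, s.2 i)) g else 0)
  unfold cU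
  rw [dist_eq, dist_eq]
  simp only [Fintype.sum_prod_type (α₁ := O2 X1 X2 W Xt1 Xt2 n k1 k2),
    Fintype.sum_prod_type (α₁ := O1 X1 X2 W n k1 k2),
    Fintype.sum_prod_type (α₁ := Fin n → X1 × X2 × W)]
  refine Eq.trans ?_ (h.symm.trans ?_)
  · refine Finset.sum_congr rfl fun x _ => ?_
    by_cases hx : x t = d
    · simp only [hx, if_true, Prod.mk.injEq, true_and, Finset.mul_sum]
      refine Finset.sum_congr rfl fun k _ => Finset.sum_congr rfl fun s _ =>
        Finset.sum_congr rfl fun g _ => ?_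
      split_ifs
      · simp only [m3, m2, m1, kp, pp]
        ring
      · simp
    · simp [hx]
  · congr 1
    refine Finset.sum_congr rfl fun x _ => ?_
    simp only [Finset.mul_sum]
    refine Finset.sum_congr rfl fun k _ => Finset.sum_congr rfl fun s _ =>
        Finset.sum_congr rfl fun g _ => ?_
    have ev : vUU w0 t (((Function.update x t d, k), s), g) = vUU w0 t (((x, k), s), g) := by
      simp only [vUU, upd_upd]
    rw [ev]
    by_cases hu : vUU w0 t (((x, k), s), g) = u
    · rw [if_pos hu, if_pos hu]
      simp only [m3, m2, m1, kp, pp, encU_eq]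
      ring
    · rw [if_neg hu, if_neg hu]
      simp

lemma src_match (hq : IsPMF q) (t : Fin n) (x1 : X1) (x2 : X2) (w : W)
    (u1 : Fin k1 × (Fin n → Yt) × (Fin n → W)) (u2 : Fin k2) (y : Y) :
    dist (m4 q ch (encC C) (decC C))
      (fun ω => (vX1 ω t, vX2 ω t, vW ω t, vU w0 t ω, (vK ω).2, vY ω t))
      (x1, x2, w, u1, u2, y) =
    srcP q (x1, x2, w) * cU q ch C w0 x1 x2 t (u1, u2) * cY C u1 u2 w t y := by
  rw [← src_match3 C w0 hq t (x1, x2, w) (u1, u2)]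
  have h := dist_kp_cond (m3 q ch (encC C))
    (fun r => decC C r.1.1.2 (fun i => (r.1.1.1 i).2.2) (fun i => (r.2 i).1))
    (fun ω => (ω.1.1.1 t, vUU w0 t ω)) (fun y : Fin n → Y => y t) ((x1, x2, w), (u1, u2)) y
    (cY C u1 u2 w t y) (by
      intro r hr
      simp only [vUU, Prod.mk.injEq] at hr
      obtain ⟨h1, h2, h3⟩ := hr
      subst h2
      subst h3
      simp only [cY, Function.update_idem]
      have : Function.update (fun i => (r.1.1.1 i).2.2) t w = fun i => (r.1.1.1 i).2.2 := by
        rw [Function.update_eq_self_iff, h1]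
      rw [this])
  rw [← h]
  refine dist_congr_event _ _ _ _ _ fun ω => ?_
  simp only [vX1, vX2, vW, vU, vK, vV, vY, vUU, Prod.mk.injEq, Prod.ext_iff]
  tauto

lemma chan_match (hch : ∀ x, IsPMF (ch x)) (t : Fin n) (a1 : Xt1) (a2 : Xt2) (v : Yt) (z : Zt) :
    dist (m4 q ch (encC C) (decC C)) (fun ω => (vS1 ω t, vS2 ω t, vV ω t, vZ ω t))
      (a1, a2, v, z) = cX q ch C t (a1, a2) * ch (a1, a2) (v, z) := by
  have h := dist_kernel_comp (m3 q ch (encC C)) (fun ω => ω.1) (fun ω => ω.2 t)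
      (fun r => (r.2.1 t, r.2.2 t)) ch (dist_chan hch (encC C) t) (a1, a2) (v, z)
  have e1 : dist (m3 q ch (encC C)) (fun ω => (ω.1.2.1 t, ω.1.2.2 t)) = cX q ch C t := by
    unfold cX m4
    exact (dist_kp_fst (fun r => decC_pmf C _ _ _)
      (fun ω : O3 X1 X2 W Xt1 Xt2 Yt Zt n k1 k2 => (ω.1.2.1 t, ω.1.2.2 t))).symm
  rw [e1] at h
  rw [← h]
  have e2 := dist_kp_fst (m := m3 q ch (encC C))
    (κ := fun r => decC C r.1.1.2 (fun i => (r.1.1.1 i).2.2) (fun i => (r.2 i).1))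
    (fun r => decC_pmf C _ _ _)
    (fun ω : O3 X1 X2 W Xt1 Xt2 Yt Zt n k1 k2 => ((ω.1.2.1 t, ω.1.2.2 t), ω.2 t))
  rw [← e2]
  refine dist_congr_event _ _ _ _ _ fun ω => ?_
  simp only [vS1, vS2, vV, vZ, Prod.mk.injEq, Prod.ext_iff]
  tauto

end SingleLetter

section Assemble

set_option linter.unusedSectionVars false
set_option linter.unusedSimpArgs false

variable {n k1 k2 : ℕ} (q : X1 × X2 × W × Y → ℝ)
    (ch : Xt1 × Xt2 → Yt × Zt → ℝ)
    (C : Code X1 X2 W Y Xt1 Xt2 Yt n k1 k2) (w0 : W)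

/-- The single-letter joint pmf. -/
noncomputable def muC : Omega1 X1 X2 W Y Xt1 Xt2 Yt Zt (Fin n)
    (Fin k1 × (Fin n → Yt) × (Fin n → W)) (Fin k2) → ℝ :=
  fun (x1, x2, w, t, u1, u2, a1, a2, yt, zt, y) =>
    (∑ y' : Y, q (x1, x2, w, y')) * (1 / (n : ℝ)) * cU q ch C w0 x1 x2 t (u1, u2) *
      cX q ch C t (a1, a2) * ch (a1, a2) (yt, zt) * cY C u1 u2 w t y

/-- Coordinates with the source part last. -/
def eSrc (X1 X2 W Y Xt1 Xt2 Yt Zt T U1 U2 : Type) :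
    (Xt1 × Xt2 × Yt × Zt) × ((X1 × X2 × W × U1 × U2 × Y) × T) ≃
      Omega1 X1 X2 W Y Xt1 Xt2 Yt Zt T U1 U2 where
  toFun := fun ((a1, a2, yt, zt), ((x1, x2, w, u1, u2, y), t)) =>
    (x1, x2, w, t, u1, u2, a1, a2, yt, zt, y)
  invFun := fun (x1, x2, w, t, u1, u2, a1, a2, yt, zt, y) =>
    ((a1, a2, yt, zt), ((x1, x2, w, u1, u2, y), t))
  left_inv := fun _ => rfl
  right_inv := fun _ => rfl

/-- Coordinates with the channel part last. -/
def eCh (X1 X2 W Y Xt1 Xt2 Yt Zt T U1 U2 : Type) :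
    (X1 × X2 × W × U1 × U2 × Y) × ((Xt1 × Xt2 × Yt × Zt) × T) ≃
      Omega1 X1 X2 W Y Xt1 Xt2 Yt Zt T U1 U2 where
  toFun := fun ((x1, x2, w, u1, u2, y), ((a1, a2, yt, zt), t)) =>
    (x1, x2, w, t, u1, u2, a1, a2, yt, zt, y)
  invFun := fun (x1, x2, w, t, u1, u2, a1, a2, yt, zt, y) =>
    ((x1, x2, w, u1, u2, y), ((a1, a2, yt, zt), t))
  left_inv := fun _ => rfl
  right_inv := fun _ => rfl

variable {q ch}

lemma muC_src (hq : IsPMF q) (h1 : 1 ≤ k1) (h2 : 1 ≤ k2) (hch : ∀ x, IsPMF (ch x))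
    (a : X1 × X2 × W × (Fin k1 × (Fin n → Yt) × (Fin n → W)) × Fin k2 × Y) (t : Fin n) :
    dist (muC q ch C w0)
      (fun ω => ((wX1 ω, wX2 ω, wW ω, wU1 ω, wU2 ω, wY ω), wT ω)) (a, t) =
    1 / (n : ℝ) * dist (m4 q ch (encC C) (decC C))
      (fun ω => (vX1 ω t, vX2 ω t, vW ω t, vU w0 t ω, (vK ω).2, vY ω t)) a := by
  have hM := m4_pmf hq h1 h2 hch (encC_pmf C) (decC_pmf C)
  obtain ⟨x1, x2, w, u1, u2, y⟩ := a
  rw [dist_of_equiv _ _ (eSrc X1 X2 W Y Xt1 Xt2 Yt Zt (Fin n)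
    (Fin k1 × (Fin n → Yt) × (Fin n → W)) (Fin k2)) (fun _ _ => rfl), src_match C w0 hq]
  have hs := sum_dist (m4 q ch (encC C) (decC C))
    (fun ω => (vS1 ω t, vS2 ω t, vV ω t, vZ ω t))
  rw [hM.2] at hs
  calc _ = ∑ r : Xt1 × Xt2 × Yt × Zt, (1 / (n : ℝ) * (srcP q (x1, x2, w) *
        cU q ch C w0 x1 x2 t (u1, u2) * cY C u1 u2 w t y)) *
        dist (m4 q ch (encC C) (decC C))
          (fun ω => (vS1 ω t, vS2 ω t, vV ω t, vZ ω t)) r := by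
        refine Finset.sum_congr rfl fun r _ => ?_
        obtain ⟨a1, a2, yt, zt⟩ := r
        rw [chan_match C hch]
        simp only [eSrc, muC, srcP, Equiv.coe_fn_mk]
        ring
    _ = _ := by rw [← Finset.mul_sum, hs, mul_one]

lemma muC_ch (hq : IsPMF q) (h1 : 1 ≤ k1) (h2 : 1 ≤ k2) (hch : ∀ x, IsPMF (ch x))
    (a : Xt1 × Xt2 × Yt × Zt) (t : Fin n) :
    dist (muC q ch C w0)
      (fun ω => ((wA1 ω, wA2 ω, wYt ω, wZt ω), wT ω)) (a, t) =
    1 / (n : ℝ) * dist (m4 q ch (encC C) (decC C))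
      (fun ω => (vS1 ω t, vS2 ω t, vV ω t, vZ ω t)) a := by
  have hM := m4_pmf hq h1 h2 hch (encC_pmf C) (decC_pmf C)
  obtain ⟨a1, a2, yt, zt⟩ := a
  rw [dist_of_equiv _ _ (eCh X1 X2 W Y Xt1 Xt2 Yt Zt (Fin n)
    (Fin k1 × (Fin n → Yt) × (Fin n → W)) (Fin k2)) (fun _ _ => rfl), chan_match C hch]
  have hs := sum_dist (m4 q ch (encC C) (decC C))
    (fun ω => (vX1 ω t, vX2 ω t, vW ω t, vU w0 t ω, (vK ω).2, vY ω t))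
  rw [hM.2] at hs
  calc _ = ∑ r : X1 × X2 × W × (Fin k1 × (Fin n → Yt) × (Fin n → W)) × Fin k2 × Y,
        (1 / (n : ℝ) * (cX q ch C t (a1, a2) * ch (a1, a2) (yt, zt))) *
        dist (m4 q ch (encC C) (decC C))
          (fun ω => (vX1 ω t, vX2 ω t, vW ω t, vU w0 t ω, (vK ω).2, vY ω t)) r := by
        refine Finset.sum_congr rfl fun r _ => ?_
        obtain ⟨x1, x2, w, u1, u2, y⟩ := r
        rw [src_match C w0 hq]
        simp only [eCh, muC, srcP, Equiv.coe_fn_mk]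
        ring
    _ = _ := by rw [← Finset.mul_sum, hs, mul_one]

lemma marg_match (hq : IsPMF q) (h1 : 1 ≤ k1) (h2 : 1 ≤ k2) (hch : ∀ x, IsPMF (ch x))
    (t : Fin n) :
    (fun v : X1 × X2 × W × Y =>
          ∑ u1 : Fin k1 × (Fin n → Yt) × (Fin n → W), ∑ u2 : Fin k2,
            ∑ a1 : Xt1, ∑ a2 : Xt2, ∑ yt : Yt, ∑ zt : Zt,
            (∑ y' : Y, q (v.1, v.2.1, v.2.2.1, y')) * cU q ch C w0 v.1 v.2.1 t (u1, u2) *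
              cX q ch C t (a1, a2) * ch (a1, a2) (yt, zt) * cY C u1 u2 v.2.2.1 t v.2.2.2) =
      dist (m4 q ch (encC C) (decC C)) (fun ω => vB ω t) := by
  have hM := m4_pmf hq h1 h2 hch (encC_pmf C) (decC_pmf C)
  funext v
  obtain ⟨x1, x2, w, y⟩ := v
  have hs := sum_dist (m4 q ch (encC C) (decC C))
    (fun ω => (vS1 ω t, vS2 ω t, vV ω t, vZ ω t))
  rw [hM.2] at hs
  simp only [Fintype.sum_prod_type] at hs
  have hm := dist_marg (m4 q ch (encC C) (decC C)) (fun ω => vB ω t)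
    (fun ω => (vU w0 t ω, (vK ω).2)) (x1, x2, w, y)
  rw [← hm, Fintype.sum_prod_type (α₂ := Fin k2)]
  refine Finset.sum_congr rfl fun u1 _ => ?_
  refine Finset.sum_congr rfl fun u2 _ => ?_
  have e : dist (m4 q ch (encC C) (decC C)) (fun ω => (vB ω t, vU w0 t ω, (vK ω).2))
      ((x1, x2, w, y), u1, u2) = srcP q (x1, x2, w) * cU q ch C w0 x1 x2 t (u1, u2) *
        cY C u1 u2 w t y := by
    rw [← src_match C w0 hq]
    refine dist_congr_event _ _ _ _ _ fun ω => ?_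
    simp only [vB, Prod.mk.injEq]
    tauto
  rw [e]
  calc _ = ∑ a1 : Xt1, ∑ a2 : Xt2, ∑ yt : Yt, ∑ zt : Zt,
        (srcP q (x1, x2, w) * cU q ch C w0 x1 x2 t (u1, u2) * cY C u1 u2 w t y) *
        dist (m4 q ch (encC C) (decC C)) (fun ω => (vS1 ω t, vS2 ω t, vV ω t, vZ ω t))
          (a1, a2, yt, zt) := by
        refine Finset.sum_congr rfl fun a1 _ => Finset.sum_congr rfl fun a2 _ =>
          Finset.sum_congr rfl fun yt _ => Finset.sum_congr rfl fun zt _ => ?_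
        rw [chan_match C hch]
        simp only [srcP]
        ring
    _ = _ := by
        simp only [← Finset.mul_sum]
        rw [hs, mul_one]

end Assemble

section Final

set_option linter.unusedSectionVars false
set_option linter.unusedSimpArgs false

variable {n k1 k2 : ℕ} {q : X1 × X2 × W × Y → ℝ} (hq : IsPMF q) (h1 : 1 ≤ k1) (h2 : 1 ≤ k2)
    {ch : Xt1 × Xt2 → Yt × Zt → ℝ} (hch : ∀ x, IsPMF (ch x))
    (C : Code X1 X2 W Y Xt1 Xt2 Yt n k1 k2) (w0 : W) (hn : 0 < n)

include hq h1 h2 hch hn in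
lemma mix_src {α β γ : Type} [Fintype α] [Fintype β] [Fintype γ]
    (A : X1 × X2 × W × (Fin k1 × (Fin n → Yt) × (Fin n → W)) × Fin k2 × Y → α)
    (B : X1 × X2 × W × (Fin k1 × (Fin n → Yt) × (Fin n → W)) × Fin k2 × Y → β)
    (D : X1 × X2 × W × (Fin k1 × (Fin n → Yt) × (Fin n → W)) × Fin k2 × Y → γ) :
    CMI (muC q ch C w0)
      (fun ω => A (wX1 ω, wX2 ω, wW ω, wU1 ω, wU2 ω, wY ω))
      (fun ω => B (wX1 ω, wX2 ω, wW ω, wU1 ω, wU2 ω, wY ω))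
      (fun ω => (D (wX1 ω, wX2 ω, wW ω, wU1 ω, wU2 ω, wY ω), wT ω)) =
    1 / (n : ℝ) * ∑ t, CMI (m4 q ch (encC C) (decC C))
      (fun ω => A (vX1 ω t, vX2 ω t, vW ω t, vU w0 t ω, (vK ω).2, vY ω t))
      (fun ω => B (vX1 ω t, vX2 ω t, vW ω t, vU w0 t ω, (vK ω).2, vY ω t))
      (fun ω => D (vX1 ω t, vX2 ω t, vW ω t, vU w0 t ω, (vK ω).2, vY ω t)) :=
  CMI_mix hn (muC q ch C w0) wT (fun ω => (wX1 ω, wX2 ω, wW ω, wU1 ω, wU2 ω, wY ω))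
    (m4_pmf hq h1 h2 hch (encC_pmf C) (decC_pmf C))
    (fun t ω => (vX1 ω t, vX2 ω t, vW ω t, vU w0 t ω, (vK ω).2, vY ω t))
    (muC_src C w0 hq h1 h2 hch) A B D

include hq h1 h2 hch hn in
lemma mix_ch {α β γ : Type} [Fintype α] [Fintype β] [Fintype γ]
    (A : Xt1 × Xt2 × Yt × Zt → α) (B : Xt1 × Xt2 × Yt × Zt → β) (D : Xt1 × Xt2 × Yt × Zt → γ) :
    CMI (muC q ch C w0)
      (fun ω => A (wA1 ω, wA2 ω, wYt ω, wZt ω))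
      (fun ω => B (wA1 ω, wA2 ω, wYt ω, wZt ω))
      (fun ω => (D (wA1 ω, wA2 ω, wYt ω, wZt ω), wT ω)) =
    1 / (n : ℝ) * ∑ t, CMI (m4 q ch (encC C) (decC C))
      (fun ω => A (vS1 ω t, vS2 ω t, vV ω t, vZ ω t))
      (fun ω => B (vS1 ω t, vS2 ω t, vV ω t, vZ ω t))
      (fun ω => D (vS1 ω t, vS2 ω t, vV ω t, vZ ω t)) :=
  CMI_mix hn (muC q ch C w0) wT (fun ω => (wA1 ω, wA2 ω, wYt ω, wZt ω))
    (m4_pmf hq h1 h2 hch (encC_pmf C) (decC_pmf C))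
    (fun t ω => (vS1 ω t, vS2 ω t, vV ω t, vZ ω t))
    (muC_ch C w0 hq h1 h2 hch) A B D

include hq h1 h2 hch hn in
lemma sl_a : CMI (muC q ch C w0) wU1 wX1 (fun ω => (wU2 ω, wX2 ω, wW ω, wT ω)) ≤
    CMI (muC q ch C w0) wA1 wYt (fun ω => (wA2 ω, wT ω)) := by
  rw [CMI_congr (muC q ch C w0) wU1 wX1 (fun ω => (wU2 ω, wX2 ω, wW ω, wT ω))
      (fun ω => wU1 ω) (fun ω => wX1 ω) (fun ω => ((wU2 ω, wX2 ω, wW ω), wT ω))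
      (fun _ _ => Iff.rfl) (fun _ _ => Iff.rfl)
      (by intro ω ω'; simp only [Prod.mk.injEq]; tauto)]
  have e1 := mix_src hq h1 h2 hch C w0 hn (fun s => s.2.2.2.1) (fun s => s.1)
    (fun s => (s.2.2.2.2.1, s.2.1, s.2.2.1))
  have e2 := mix_ch hq h1 h2 hch C w0 hn (fun s => s.1) (fun s => s.2.2.1) (fun s => s.2.1)
  refine (le_of_eq e1).trans (le_trans ?_ (le_of_eq e2.symm))
  exact mul_le_mul_of_nonneg_left (ineq_a hq h1 h2 hch C w0) (by positivity)

include hq h1 h2 hch hn in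
lemma sl_b : CMI (muC q ch C w0) wU2 wX2 (fun ω => (wU1 ω, wX1 ω, wW ω, wT ω)) ≤
    CMI (muC q ch C w0) wA2 wYt (fun ω => (wA1 ω, wT ω)) := by
  rw [CMI_congr (muC q ch C w0) wU2 wX2 (fun ω => (wU1 ω, wX1 ω, wW ω, wT ω))
      (fun ω => wU2 ω) (fun ω => wX2 ω) (fun ω => ((wU1 ω, wX1 ω, wW ω), wT ω))
      (fun _ _ => Iff.rfl) (fun _ _ => Iff.rfl)
      (by intro ω ω'; simp only [Prod.mk.injEq]; tauto)]
  have e1 := mix_src hq h1 h2 hch C w0 hn (fun s => s.2.2.2.2.1) (fun s => s.2.1)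
    (fun s => (s.2.2.2.1, s.1, s.2.2.1))
  have e2 := mix_ch hq h1 h2 hch C w0 hn (fun s => s.2.1) (fun s => s.2.2.1) (fun s => s.1)
  refine (le_of_eq e1).trans (le_trans ?_ (le_of_eq e2.symm))
  exact mul_le_mul_of_nonneg_left (ineq_b hq h1 h2 hch C w0) (by positivity)

include hq h1 h2 hch hn in
lemma sl_c : CMI (muC q ch C w0) (fun ω => (wU1 ω, wU2 ω)) (fun ω => (wX1 ω, wX2 ω))
      (fun ω => (wW ω, wT ω)) ≤
    CMI (muC q ch C w0) (fun ω => (wA1 ω, wA2 ω)) wYt wT := by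
  rw [CMI_congr (muC q ch C w0) (fun ω => (wA1 ω, wA2 ω)) wYt wT
      (fun ω => (wA1 ω, wA2 ω)) wYt (fun ω => ((), wT ω))
      (fun _ _ => Iff.rfl) (fun _ _ => Iff.rfl) (by intro ω ω'; simp)]
  have e1 := mix_src hq h1 h2 hch C w0 hn (fun s => (s.2.2.2.1, s.2.2.2.2.1))
    (fun s => (s.1, s.2.1)) (fun s => s.2.2.1)
  have e2 := mix_ch hq h1 h2 hch C w0 hn (fun s => (s.1, s.2.1)) (fun s => s.2.2.1) (fun _ => ())
  refine (le_of_eq e1).trans (le_trans ?_ (le_of_eq e2.symm))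
  exact mul_le_mul_of_nonneg_left (ineq_c hq h1 h2 hch C w0) (by positivity)

include hq h1 h2 hch hn in
lemma sl_condEnt : condEnt (muC q ch C w0) wY (fun ω => (wX1 ω, wX2 ω, wW ω, wT ω)) =
    1 / (n : ℝ) * ∑ t, condEnt (m4 q ch (encC C) (decC C)) (fun ω => vY ω t)
      (fun ω => (vX1 ω t, vX2 ω t, vW ω t)) := by
  have e := condEnt_mix hn (muC q ch C w0) wT
    (fun ω => (wX1 ω, wX2 ω, wW ω, wU1 ω, wU2 ω, wY ω))
    (m4_pmf hq h1 h2 hch (encC_pmf C) (decC_pmf C))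
    (fun t ω => (vX1 ω t, vX2 ω t, vW ω t, vU w0 t ω, (vK ω).2, vY ω t))
    (muC_src C w0 hq h1 h2 hch) (fun s => s.2.2.2.2.2) (fun s => (s.1, s.2.1, s.2.2.1))
  refine Eq.trans ?_ e
  unfold condEnt
  rw [H_congr (muC q ch C w0) (fun ω => (wY ω, wX1 ω, wX2 ω, wW ω, wT ω))
      (fun ω => (wY ω, (wX1 ω, wX2 ω, wW ω), wT ω))
      (by intro ω ω'; simp only [Prod.mk.injEq]; tauto),
    H_congr (muC q ch C w0) (fun ω => (wX1 ω, wX2 ω, wW ω, wT ω))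
      (fun ω => ((wX1 ω, wX2 ω, wW ω), wT ω))
      (by intro ω ω'; simp only [Prod.mk.injEq]; tauto)]

include hq h1 h2 hch hn in
lemma sl_Z : CMI (muC q ch C w0) (fun ω => (wA1 ω, wA2 ω)) wYt (fun ω => (wZt ω, wT ω)) =
    1 / (n : ℝ) * ∑ t, CMI (m4 q ch (encC C) (decC C)) (fun ω => (vS1 ω t, vS2 ω t))
      (fun ω => vV ω t) (fun ω => vZ ω t) :=
  mix_ch hq h1 h2 hch C w0 hn (fun s => (s.1, s.2.1)) (fun s => s.2.2.1) (fun s => s.2.2.2)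

/-- Normalization step. -/
lemma norm_step {n : ℕ} (hn : 0 < n) {S L Y Z d0 R c : ℝ} (h : S ≤ L + Y + Z + 2 * (2 * n * d0))
    (hL : L ≤ n * R) (hc : c = 1 / (n : ℝ) * S) :
    c ≤ R + 1 / (n : ℝ) * Y + 1 / (n : ℝ) * Z + 4 * d0 := by
  have hn' : (0 : ℝ) < n := by exact_mod_cast hn
  rw [hc]
  have : 1 / (n : ℝ) * S ≤ 1 / (n : ℝ) * (n * R + Y + Z + 2 * (2 * n * d0)) :=
    mul_le_mul_of_nonneg_left (by linarith) (by positivity)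
  refine this.trans (le_of_eq ?_)
  field_simp
  ring

lemma logb_le_of {k n : ℕ} {R : ℝ} (hk : 1 ≤ k) (h : (k : ℝ) ≤ 2 ^ ((n : ℝ) * R)) :
    Real.logb 2 k ≤ n * R := by
  rw [Real.logb_le_iff_le_rpow (by norm_num) (by exact_mod_cast hk)]
  exact h

lemma gTV_pos {h ε : ℝ} {N : ℕ} (hh : 0 ≤ h) (hN : 0 < N) (hε : ε ∈ Set.Ioc (0 : ℝ) (1 / 4)) :
    0 < gTV h N ε := by
  unfold gTV
  have h1 : 0 < Real.sqrt ε := Real.sqrt_pos.2 hε.1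
  have h2 : (1 : ℝ) < N / ε := by
    rw [lt_div_iff₀ hε.1]
    have : (1 : ℝ) ≤ N := by exact_mod_cast hN
    linarith [hε.2]
  have h3 := Real.logb_pos (b := 2) (by norm_num) h2
  positivity

end Final
/-- **Theorem 2 (Outer bound).**  For every `ε ∈ (0, 1/4]`, any rate pair
`(R01, R02)` in `𝓡^secrecy_noisy-coord` admits auxiliary finite random variables
`(T, U1, U2)` with the indicated factorized joint pmf, whose conditional
`(X1, X2, W, Y)`-marginal given `T = t` is `ε`-close in total variation to the
target pmf `q` for every `t`, satisfying the inequalities (2a)–(2f). -/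
theorem outer_bound
    (q : X1 × X2 × W × Y → ℝ) (hq : IsPMF q)
    (ch : Xt1 × Xt2 → Yt × Zt → ℝ) (hch : ∀ x, IsPMF (ch x))
    (R01 R02 : ℝ)
    (hmem : (R01, R02) ∈ RegionSecrecy q ch)
    (ε : ℝ) (hε : ε ∈ Set.Ioc (0 : ℝ) (1 / 4)) :
    ∃ (T U1 U2 : Type) (_ : Fintype T) (_ : Fintype U1) (_ : Fintype U2)
      (pT : T → ℝ) (pU : X1 → X2 → T → U1 × U2 → ℝ) (pXt : T → Xt1 × Xt2 → ℝ)
      (pYc : U1 → U2 → W → T → Y → ℝ)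
      (μ : Omega1 X1 X2 W Y Xt1 Xt2 Yt Zt T U1 U2 → ℝ),
      IsPMF pT ∧ (∀ x1 x2 t, IsPMF (pU x1 x2 t)) ∧ (∀ t, IsPMF (pXt t)) ∧
      (∀ u1 u2 w t, IsPMF (pYc u1 u2 w t)) ∧
      (∀ x1 x2 w t u1 u2 a1 a2 yt zt y,
        μ (x1, x2, w, t, u1, u2, a1, a2, yt, zt, y) =
          (∑ y' : Y, q (x1, x2, w, y')) * pT t * pU x1 x2 t (u1, u2) *
            pXt t (a1, a2) * ch (a1, a2) (yt, zt) * pYc u1 u2 w t y) ∧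
      (∀ t : T, TV
        (fun v : X1 × X2 × W × Y =>
          ∑ u1 : U1, ∑ u2 : U2, ∑ a1 : Xt1, ∑ a2 : Xt2, ∑ yt : Yt, ∑ zt : Zt,
            (∑ y' : Y, q (v.1, v.2.1, v.2.2.1, y')) * pU v.1 v.2.1 t (u1, u2) *
              pXt t (a1, a2) * ch (a1, a2) (yt, zt) * pYc u1 u2 v.2.2.1 t v.2.2.2)
        q ≤ ε) ∧
      -- (2a)
      CMI μ wA1 wYt (fun ω => (wA2 ω, wT ω)) ≥
        CMI μ wU1 wX1 (fun ω => (wU2 ω, wX2 ω, wW ω, wT ω)) ∧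
      -- (2b)
      CMI μ wA2 wYt (fun ω => (wA1 ω, wT ω)) ≥
        CMI μ wU2 wX2 (fun ω => (wU1 ω, wX1 ω, wW ω, wT ω)) ∧
      -- (2c)
      CMI μ (fun ω => (wA1 ω, wA2 ω)) wYt wT ≥
        CMI μ (fun ω => (wU1 ω, wU2 ω)) (fun ω => (wX1 ω, wX2 ω)) (fun ω => (wW ω, wT ω)) ∧
      -- (2d)
      R01 + R02 ≥
        CMI μ (fun ω => (wU1 ω, wU2 ω)) (fun ω => (wX1 ω, wX2 ω, wY ω)) (fun ω => (wW ω, wT ω))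
          - condEnt μ wY (fun ω => (wX1 ω, wX2 ω, wW ω, wT ω))
          - CMI μ (fun ω => (wA1 ω, wA2 ω)) wYt (fun ω => (wZt ω, wT ω))
          - 2 * gTV (H q (fun v => v))
              (Fintype.card X1 * Fintype.card X2 * Fintype.card W *
                Fintype.card Y * Fintype.card Zt) ε ∧
      -- (2e)
      R01 ≥
        CMI μ wU1 (fun ω => (wX1 ω, wX2 ω, wY ω)) (fun ω => (wW ω, wT ω))
          - condEnt μ wY (fun ω => (wX1 ω, wX2 ω, wW ω, wT ω))
          - CMI μ (fun ω => (wA1 ω, wA2 ω)) wYt (fun ω => (wZt ω, wT ω))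
          - 2 * gTV (H q (fun v => v))
              (Fintype.card X1 * Fintype.card X2 * Fintype.card W *
                Fintype.card Y * Fintype.card Zt) ε ∧
      -- (2f)
      R02 ≥
        CMI μ wU2 (fun ω => (wX1 ω, wX2 ω, wY ω)) (fun ω => (wW ω, wT ω))
          - condEnt μ wY (fun ω => (wX1 ω, wX2 ω, wW ω, wT ω))
          - CMI μ (fun ω => (wA1 ω, wA2 ω)) wYt (fun ω => (wZt ω, wT ω))
          - 2 * gTV (H q (fun v => v))
              (Fintype.card X1 * Fintype.card X2 * Fintype.card W *
                Fintype.card Y * Fintype.card Zt) ε := by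
  classical
  obtain ⟨⟨x10, x20, w0, y0⟩⟩ := pmf_nonempty hq
  -- nonemptiness of the eavesdropper alphabet
  have hgetA : ∀ {R R' : ℝ}, Achievable q ch R R' → Nonempty Zt := by
    rintro R R' ⟨k1, k2, h1, h2, -, -, C, -⟩
    obtain ⟨s1⟩ := pmf_nonempty ((C 1).enc1_pmf (fun _ => x10) ⟨0, h1 1⟩)
    obtain ⟨s2⟩ := pmf_nonempty ((C 1).enc2_pmf (fun _ => x20) ⟨0, h2 1⟩)
    obtain ⟨v⟩ := pmf_nonempty (hch (s1 0, s2 0))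
    exact ⟨v.2⟩
  set N : ℕ := Fintype.card X1 * Fintype.card X2 * Fintype.card W *
                Fintype.card Y * Fintype.card Zt with hN
  have hZn : Nonempty Zt := by
    obtain ⟨p, hp, -⟩ := Metric.mem_closure_iff.1 hmem 1 one_pos
    exact hgetA hp
  have hZ : 0 < Fintype.card Zt := Fintype.card_pos
  have hNpos : 0 < N := by
    have a1 : 0 < Fintype.card X1 := Fintype.card_pos_iff.2 ⟨x10⟩
    have a2 : 0 < Fintype.card X2 := Fintype.card_pos_iff.2 ⟨x20⟩
    have a3 : 0 < Fintype.card W := Fintype.card_pos_iff.2 ⟨w0⟩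
    have a4 : 0 < Fintype.card Y := Fintype.card_pos_iff.2 ⟨y0⟩
    positivity
  have hg : 0 < gTV (H q (fun v => v)) N ε := gTV_pos (H_nonneg hq _) hNpos hε
  set g : ℝ := gTV (H q (fun v => v)) N ε with hgdef
  obtain ⟨⟨R1, R2⟩, hp, hd⟩ := Metric.mem_closure_iff.1 hmem (g / 4) (by positivity)
  rw [Prod.dist_eq, max_lt_iff, Real.dist_eq, Real.dist_eq] at hd
  have hR1 := (abs_lt.1 hd.1).1
  have hR2 := (abs_lt.1 hd.2).1
  simp only at hR1 hR2
  obtain ⟨k1, k2, h1, h2, hk1, hk2, C, hC⟩ := hp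
  have hmod := (modu_tendsto (N : ℝ)).eventually (gt_mem_nhds (show (0 : ℝ) < g / 8 by positivity))
  obtain ⟨τ0, hτ0, hτ⟩ := Metric.eventually_nhds_iff.1 hmod
  have hev : ∀ᶠ n in Filter.atTop, tv q ch (C n) < min τ0 ε :=
    hC.eventually (gt_mem_nhds (lt_min hτ0 hε.1))
  obtain ⟨n, hn, htv⟩ := ((Filter.eventually_ge_atTop 1).and hev).exists
  have hn0 : 0 < n := hn
  have ht1 : tv q ch (C n) < τ0 := lt_of_lt_of_le htv (min_le_left _ _)
  have ht2 : tv q ch (C n) < ε := lt_of_lt_of_le htv (min_le_right _ _)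
  have hM := m4_pmf hq (h1 n) (h2 n) hch (encC_pmf (C n)) (decC_pmf (C n))
  have hE := factE (C n) hq hch (h1 n) (h2 n) hn0 hZ (g / 8) (by linarith [hε.2]) (by
    intro τ t0 t1
    refine le_of_lt (hτ ?_)
    rw [Real.dist_eq, sub_zero, abs_of_nonneg t0]
    linarith)
  have hl1 := logb_le_of (h1 n) (hk1 n)
  have hl2 := logb_le_of (h2 n) (hk2 n)
  have eY := sl_condEnt hq (h1 n) (h2 n) hch (C n) w0 hn0
  have eZ := sl_Z hq (h1 n) (h2 n) hch (C n) w0 hn0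
  refine ⟨Fin n, Fin (k1 n) × (Fin n → Yt) × (Fin n → W), Fin (k2 n), inferInstance,
    inferInstance, inferInstance, fun _ => 1 / (n : ℝ), cU q ch (C n) w0, cX q ch (C n),
    cY (C n), muC q ch (C n) w0, ?_, ?_, ?_, ?_, ?_, ?_, ?_, ?_, ?_, ?_, ?_, ?_⟩
  · refine ⟨fun _ => by positivity, ?_⟩
    have : (n : ℝ) ≠ 0 := by exact_mod_cast hn0.ne'
    simp [this]
  · intro x1 x2 t
    exact dist_pmf (m3_pmf hq (h1 n) (h2 n) hch (encU_pmf (C n) t x1 x2)) _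
  · intro t
    exact dist_pmf hM _
  · intro u1 u2 w t
    exact dist_pmf (decC_pmf (C n) _ _ _) _
  · intros
    rfl
  · intro t
    refine le_trans (le_of_eq ?_) ((tv_Bt (C n) hq hch (h1 n) (h2 n) t).trans ht2.le)
    rw [← marg_match (C n) w0 hq (h1 n) (h2 n) hch t]
  · exact sl_a hq (h1 n) (h2 n) hch (C n) w0 hn0
  · exact sl_b hq (h1 n) (h2 n) hch (C n) w0 hn0
  · exact sl_c hq (h1 n) (h2 n) hch (C n) w0 hn0
  · have h := norm_step (R := R1 + R2) hn0 (ineq_d hq (h1 n) (h2 n) hch (C n) w0 hE)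
      (by linarith) (mix_src hq (h1 n) (h2 n) hch (C n) w0 hn0
        (fun s => (s.2.2.2.1, s.2.2.2.2.1)) (fun s => (s.1, s.2.1, s.2.2.2.2.2))
        (fun s => s.2.2.1))
    rw [← eY, ← eZ] at h
    linarith
  · have h := norm_step (R := R1) hn0 (ineq_e hq (h1 n) (h2 n) hch (C n) w0 hE)
      hl1 (mix_src hq (h1 n) (h2 n) hch (C n) w0 hn0
        (fun s => s.2.2.2.1) (fun s => (s.1, s.2.1, s.2.2.2.2.2))
        (fun s => s.2.2.1))
    rw [← eY, ← eZ] at h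
    change CMI (muC q ch (C n) w0) wU1 (fun ω => (wX1 ω, wX2 ω, wY ω)) (fun ω => (wW ω, wT ω)) ≤ _
      at h
    linarith
  · have h := norm_step (R := R2) hn0 (ineq_f hq (h1 n) (h2 n) hch (C n) hE)
      hl2 (mix_src hq (h1 n) (h2 n) hch (C n) w0 hn0
        (fun s => s.2.2.2.2.1) (fun s => (s.1, s.2.1, s.2.2.2.2.2))
        (fun s => s.2.2.1))
    rw [← eY, ← eZ] at h
    change CMI (muC q ch (C n) w0) wU2 (fun ω => (wX1 ω, wX2 ω, wY ω)) (fun ω => (wW ω, wT ω)) ≤ _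
      at h
    linarith

end OuterBound

end SecCoord
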